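/- arXiv:0906.0199 — 2 statements merged into one kernel-verified Lean document; each statement's English description precedes it below -/
import Mathlib

section
/- If X is a locally k-distance set on S^{d-1} attaining |X| = binom(d+k-1,k) + binom(d+k-2,k-1), then X is a k-distance set (i.e., the total number of distinct distances in X is exactly k). -/
open scoped Classical

/-- `A_X(x)`: the set of distances from `x` to the other points of `X`. -/
noncomputable def distancesFrom {d : ℕ} (X : Finset (EuclideanSpace ℝ (Fin d)))
    (x : EuclideanSpace ℝ (Fin d)) : Finset ℝ :=
  (X.erase x).image (fun y => dist x y)

/-- `A(X)`: the set of distances between distinct points of `X`. -/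
noncomputable def distSet {d : ℕ} (X : Finset (EuclideanSpace ℝ (Fin d))) : Finset ℝ :=
  X.offDiag.image (fun p => dist p.1 p.2)

/-- Complex linear forms restricted to the unit sphere of `ℝ^d`. -/
noncomputable def sphereLinearForms (d : ℕ) :
    Submodule ℂ ({ξ : EuclideanSpace ℝ (Fin d) // ‖ξ‖ = 1} → ℂ) :=
  Submodule.span ℂ (Set.range fun (i : Fin d) ξ => ((ξ.1 i : ℝ) : ℂ))

/-- Complex polynomials of degree at most `k` restricted to the unit sphere of `ℝ^d`, as the
sum of the homogeneous ones of degrees `k` and `k - 1`. -/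
noncomputable def spherePolys (d k : ℕ) :
    Submodule ℂ ({ξ : EuclideanSpace ℝ (Fin d) // ‖ξ‖ = 1} → ℂ) :=
  sphereLinearForms d ^ k ⊔ sphereLinearForms d ^ (k - 1)

lemma sphereLinearForms_pow_fg (d n : ℕ) : (sphereLinearForms d ^ n).FG :=
  (Submodule.fg_span (Set.finite_range _)).pow n

lemma finrank_sphereLinearForms_pow_le (d n : ℕ) :
    Module.finrank ℂ ↥(sphereLinearForms d ^ n) ≤ (d + n - 1).choose n := by
  let e : Fin d → {ξ : EuclideanSpace ℝ (Fin d) // ‖ξ‖ = 1} → ℂ :=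
    fun i ξ => ((ξ.1 i : ℝ) : ℂ)
  have hle : sphereLinearForms d ^ n ≤
      Submodule.span ℂ (Set.range fun s : Sym (Fin d) n => ((s : Multiset (Fin d)).map e).prod) := by
    rw [sphereLinearForms, Submodule.span_pow]
    apply Submodule.span_mono
    intro a ha
    obtain ⟨f, rfl⟩ := Set.mem_pow.1 ha
    choose g hg using fun i => (f i).2
    refine ⟨⟨((List.ofFn g : List (Fin d)) : Multiset (Fin d)), by simp⟩, ?_⟩
    simp only [Sym.coe_mk, Multiset.map_coe, Multiset.prod_coe, List.map_ofFn]
    congr 2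
    funext i
    exact hg i
  have : Module.Finite ℂ ↥(Submodule.span ℂ
      (Set.range fun s : Sym (Fin d) n => ((s : Multiset (Fin d)).map e).prod)) :=
    Module.Finite.span_of_finite ℂ (Set.finite_range _)
  calc Module.finrank ℂ ↥(sphereLinearForms d ^ n)
      ≤ Module.finrank ℂ (Submodule.span ℂ
          (Set.range fun s : Sym (Fin d) n => ((s : Multiset (Fin d)).map e).prod)) :=
        Submodule.finrank_mono hle
    _ ≤ Fintype.card (Sym (Fin d) n) := finrank_range_le_card _
    _ = (d + n - 1).choose n := by simp [Sym.card_sym_eq_choose]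

lemma finrank_spherePolys_le (d : ℕ) {k : ℕ} (hk : 1 ≤ k) :
    Module.finrank ℂ ↥(spherePolys d k) ≤
      (d + k - 1).choose k + (d + k - 2).choose (k - 1) := by
  have : Module.Finite ℂ ↥(sphereLinearForms d ^ k) :=
    Module.Finite.iff_fg.2 (sphereLinearForms_pow_fg d k)
  have : Module.Finite ℂ ↥(sphereLinearForms d ^ (k - 1)) :=
    Module.Finite.iff_fg.2 (sphereLinearForms_pow_fg d (k - 1))
  refine (Submodule.finrank_add_le_finrank_add_finrank _ _).trans ?_
  have h := finrank_sphereLinearForms_pow_le d (k - 1)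
  rw [show d + (k - 1) - 1 = d + k - 2 by omega] at h
  exact Nat.add_le_add (finrank_sphereLinearForms_pow_le d k) h

lemma spherePolys_fg (d k : ℕ) : (spherePolys d k).FG :=
  (sphereLinearForms_pow_fg d k).sup (sphereLinearForms_pow_fg d (k - 1))

lemma one_mem_sphereLinearForms_sq (d : ℕ) :
    (1 : {ξ : EuclideanSpace ℝ (Fin d) // ‖ξ‖ = 1} → ℂ) ∈ sphereLinearForms d ^ 2 := by
  have h : (1 : {ξ : EuclideanSpace ℝ (Fin d) // ‖ξ‖ = 1} → ℂ) =
      ∑ i, (fun ξ => ((ξ.1 i : ℝ) : ℂ)) * (fun ξ => ((ξ.1 i : ℝ) : ℂ)) := by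
    funext ξ
    have h1 := EuclideanSpace.real_norm_sq_eq ξ.1
    rw [ξ.2, one_pow] at h1
    simp only [Finset.sum_apply, Pi.one_apply, ← sq, Pi.pow_apply]
    exact_mod_cast h1
  rw [h, sq]
  refine Submodule.sum_mem _ fun i _ => Submodule.mul_mem_mul ?_ ?_ <;>
    exact Submodule.subset_span ⟨i, rfl⟩

lemma sphereLinearForms_pow_le_add (d n m : ℕ) :
    sphereLinearForms d ^ n ≤ sphereLinearForms d ^ (n + 2 * m) := by
  induction m with
  | zero => simp
  | succ m ih =>
    refine ih.trans fun p hp => ?_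
    rw [show n + 2 * (m + 1) = n + 2 * m + 2 by ring, pow_add]
    simpa using Submodule.mul_mem_mul hp (one_mem_sphereLinearForms_sq d)

lemma sphereLinearForms_pow_le_spherePolys (d : ℕ) {j k : ℕ} (h : j ≤ k) :
    sphereLinearForms d ^ j ≤ spherePolys d k := by
  obtain ⟨m, hm⟩ := Nat.even_or_odd' (k - j)
  rcases hm with hm | hm
  · refine (sphereLinearForms_pow_le_add d j m).trans ?_
    rw [show j + 2 * m = k by omega]
    exact le_sup_left
  · refine (sphereLinearForms_pow_le_add d j m).trans ?_
    rw [show j + 2 * m = k - 1 by omega]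
    exact le_sup_right

lemma inner_mem_sphereLinearForms {d : ℕ} (u : EuclideanSpace ℝ (Fin d)) :
    (fun ξ : {ξ : EuclideanSpace ℝ (Fin d) // ‖ξ‖ = 1} => ((inner ℝ u ξ.1 : ℝ) : ℂ)) ∈
      sphereLinearForms d := by
  have h : (fun ξ : {ξ : EuclideanSpace ℝ (Fin d) // ‖ξ‖ = 1} => ((inner ℝ u ξ.1 : ℝ) : ℂ)) =
      ∑ i, ((u i : ℝ) : ℂ) • (fun ξ => ((ξ.1 i : ℝ) : ℂ)) := by
    funext ξ
    simp [PiLp.inner_apply, mul_comm]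
  rw [h]
  exact Submodule.sum_mem _ fun i _ => Submodule.smul_mem _ _ (Submodule.subset_span ⟨i, rfl⟩)

lemma zonal_mem_spherePolys {d k : ℕ} (u : EuclideanSpace ℝ (Fin d)) {f : Polynomial ℝ}
    (hf : f.natDegree ≤ k) :
    (fun ξ : {ξ : EuclideanSpace ℝ (Fin d) // ‖ξ‖ = 1} => ((f.eval (inner ℝ u ξ.1) : ℝ) : ℂ)) ∈
      spherePolys d k := by
  have h : (fun ξ : {ξ : EuclideanSpace ℝ (Fin d) // ‖ξ‖ = 1} =>
      ((f.eval (inner ℝ u ξ.1) : ℝ) : ℂ)) = ∑ j ∈ Finset.range (k + 1),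
        ((f.coeff j : ℝ) : ℂ) • (fun ξ => ((inner ℝ u ξ.1 : ℝ) : ℂ)) ^ j := by
    funext ξ
    simp [Polynomial.eval_eq_sum_range' (Nat.lt_succ_of_le hf)]
  rw [h]
  refine Submodule.sum_mem _ fun j hj => Submodule.smul_mem _ _ ?_
  exact sphereLinearForms_pow_le_spherePolys d (Finset.mem_range_succ_iff.1 hj)
    (Submodule.pow_mem_pow _ (inner_mem_sphereLinearForms u) j)

lemma eq_sum_eval_smul_of_finrank_le {K S ι : Type*} [Field K] [Fintype ι]
    (V : Submodule K (S → K)) [FiniteDimensional K V] (hV : Module.finrank K V ≤ Fintype.card ι)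
    (s : ι → S) (F : ι → S → K) (hF : ∀ i, F i ∈ V)
    (hs : ∀ i j, F i (s j) = if i = j then 1 else 0) (p : S → K) (hp : p ∈ V) :
    p = ∑ i, p (s i) • F i := by
  have hli : LinearIndependent K (fun i => (⟨F i, hF i⟩ : V)) := by
    rw [Fintype.linearIndependent_iff]
    intro g hg j
    have h := congrFun (congrArg Subtype.val hg) (s j)
    simpa [hs] using h
  have hspan := hli.span_eq_top_of_card_eq_finrank' (le_antisymm hli.fintype_card_le_finrank hV)
  have hmem : (⟨p, hp⟩ : V) ∈ Submodule.span K (Set.range fun i => (⟨F i, hF i⟩ : V)) := by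
    rw [hspan]; trivial
  obtain ⟨c, hc⟩ := (Submodule.mem_span_range_iff_exists_fun K).1 hmem
  have hc' : p = ∑ i, c i • F i := by
    have := congrArg Subtype.val hc
    simpa using this.symm
  have hcs : ∀ j, c j = p (s j) := fun j => by
    rw [hc']; simp [hs]
  simpa [hcs] using hc'

open Polynomial ComplexConjugate in
lemma sum_mul_coeff_mul_conj_pow {ι : Type*} (s : Finset ι) {k i l : ℕ} (f : ι → ℝ[X])
    (hf : ∀ x ∈ s, (f x).natDegree ≤ k) (hil : i + l ≤ k) (g w : ι → ℂ)
    (h : ∀ ζ : ℂ, ‖ζ‖ = 1 → ∑ x ∈ s, g x * (((f x).eval (w x * conj ζ).re : ℝ) : ℂ) =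
      ζ ^ i * conj ζ ^ l) :
    ∑ x ∈ s, g x * (f x).coeff k * conj (w x) ^ k = if i = k then 2 ^ k else 0 := by
  set P : ℂ[X] := ∑ x ∈ s, ∑ j ∈ Finset.range (k + 1), C (g x * (f x).coeff j / 2 ^ j) *
    ((C (w x) + C (conj (w x)) * X ^ 2) ^ j * X ^ (k - j)) with hP
  have hPQ : P = X ^ (k + i - l) := by
    apply eq_of_infinite_eval_eq
    refine Set.Infinite.mono (s := Metric.sphere (0 : ℂ) 1) ?_ ?_
    · intro ζ hζ
      have hζ1 : ‖ζ‖ = 1 := by simpa using hζ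
      have hz : ζ * conj ζ = 1 := by rw [Complex.mul_conj, Complex.normSq_eq_norm_sq, hζ1]; simp
      have h1 : ζ ^ k * (ζ ^ i * conj ζ ^ l) = ζ ^ (k + i - l) := by
        rw [show k + i - l = (k - l) + i by omega, pow_add]
        nth_rewrite 1 [show k = (k - l) + l by omega]
        rw [pow_add]
        linear_combination (ζ ^ (k - l) * ζ ^ i) *
          (by rw [← mul_pow, hz, one_pow] : ζ ^ l * conj ζ ^ l = 1)
      simp only [Set.mem_ofPred_eq, eval_pow, eval_X]
      rw [← h1, ← h ζ hζ1, hP, eval_finsetSum, Finset.mul_sum]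
      refine Finset.sum_congr rfl fun x hx => ?_
      rw [eval_eq_sum_range' (Nat.lt_succ_of_le (hf x hx)), eval_finsetSum]
      push_cast
      rw [Finset.mul_sum, Finset.mul_sum]
      refine Finset.sum_congr rfl fun j hj => ?_
      have hj' : j ≤ k := Finset.mem_range_succ_iff.1 hj
      have hre : (((w x * conj ζ).re : ℝ) : ℂ) = (w x * conj ζ + conj (w x) * ζ) / 2 := by
        rw [Complex.re_eq_add_conj]; simp
      have h2 : w x + conj (w x) * ζ ^ 2 = ζ * (w x * conj ζ + conj (w x) * ζ) := by
        linear_combination (-w x) * hz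
      simp only [eval_mul, eval_C, eval_pow, eval_add, eval_X]
      rw [hre, h2, mul_pow, div_pow]
      have h3 : ζ ^ k = ζ ^ j * ζ ^ (k - j) := by rw [← pow_add, Nat.add_sub_cancel' hj']
      rw [h3]
      ring
    · refine (isPreconnected_sphere (by simp) (0 : ℂ) 1).infinite_of_nontrivial
        ⟨1, by simp, -1, by simp, ?_⟩
      norm_num
  have hlin : ∀ x, (C (w x) + C (conj (w x)) * X ^ 2).natDegree ≤ 2 := fun x => by compute_degree
  have hc : ∑ x ∈ s, g x * (f x).coeff k / 2 ^ k * conj (w x) ^ k = if i = k then 1 else 0 := by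
    calc ∑ x ∈ s, g x * (f x).coeff k / 2 ^ k * conj (w x) ^ k = P.coeff (2 * k) := by
          rw [hP, finsetSum_coeff]
          refine Finset.sum_congr rfl fun x _ => ?_
          rw [finsetSum_coeff, Finset.sum_range_succ, Finset.sum_eq_zero, zero_add, coeff_C_mul,
            coeff_mul_X_pow', if_pos (by omega), show 2 * k - (k - k) = k * 2 by omega,
            coeff_pow_of_natDegree_le (hlin x)]
          · simp
          · intro j hj
            have hj' := Finset.mem_range.1 hj
            rw [coeff_C_mul, coeff_mul_X_pow', if_pos (by omega),
              coeff_eq_zero_of_natDegree_lt (p := _ ^ j), mul_zero]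
            have := natDegree_pow_le_of_le j (hlin x)
            omega
      _ = if i = k then 1 else 0 := by
          rw [hPQ, coeff_X_pow]
          exact if_congr (by omega) rfl rfl
  have h2 : (2 : ℂ) ^ k ≠ 0 := pow_ne_zero k two_ne_zero
  calc ∑ x ∈ s, g x * (f x).coeff k * conj (w x) ^ k
      = 2 ^ k * ∑ x ∈ s, g x * (f x).coeff k / 2 ^ k * conj (w x) ^ k := by
        rw [Finset.mul_sum]
        refine Finset.sum_congr rfl fun x _ => ?_
        field_simp
    _ = if i = k then 2 ^ k else 0 := by rw [hc]; split_ifs <;> simp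
open ComplexConjugate in
lemma sum_mul_pow_mul_conj_pow_of_two_mul {ι : Type*} (s : Finset ι) {k : ℕ} (c : ι → ℝ)
    (w : ι → ℂ)
    (h : ∀ i l, i + l ≤ k →
      ∑ x ∈ s, w x ^ i * conj (w x) ^ l * c x * conj (w x) ^ k = if i = k then 2 ^ k else 0)
    {a b : ℕ} (hab : a + b ≤ 2 * k) (hk : k ≤ a ∨ k ≤ b) :
    ∑ x ∈ s, (c x : ℂ) * (w x ^ a * conj (w x) ^ b) = if a = k ∧ b = k then 2 ^ k else 0 := by
  have key : ∀ a b, a + b ≤ 2 * k → k ≤ b →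
      ∑ x ∈ s, (c x : ℂ) * (w x ^ a * conj (w x) ^ b) = if a = k ∧ b = k then 2 ^ k else 0 := by
    intro a b hab hb
    calc ∑ x ∈ s, (c x : ℂ) * (w x ^ a * conj (w x) ^ b)
        = ∑ x ∈ s, w x ^ a * conj (w x) ^ (b - k) * c x * conj (w x) ^ k := by
          refine Finset.sum_congr rfl fun x _ => ?_
          rw [show conj (w x) ^ b = conj (w x) ^ (b - k) * conj (w x) ^ k by
            rw [← pow_add, Nat.sub_add_cancel hb]]
          ring
      _ = if a = k then 2 ^ k else 0 := h a (b - k) (by omega)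
      _ = if a = k ∧ b = k then 2 ^ k else 0 := if_congr (by omega) rfl rfl
  rcases hk with ha | hb
  · have h1 := congrArg conj (key b a (by omega) ha)
    rw [map_sum] at h1
    calc ∑ x ∈ s, (c x : ℂ) * (w x ^ a * conj (w x) ^ b)
        = ∑ x ∈ s, conj ((c x : ℂ) * (w x ^ b * conj (w x) ^ a)) := by
          refine Finset.sum_congr rfl fun x _ => ?_
          simp [mul_comm]
      _ = if a = k ∧ b = k then 2 ^ k else 0 := by
          rw [h1, apply_ite conj]
          simp [and_comm, Complex.conj_ofNat]
  · exact key a b hab hb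

open ComplexConjugate in
lemma sum_mul_re_pow {ι : Type*} (s : Finset ι) (c : ι → ℝ) (w : ι → ℂ) (n : ℕ) :
    ((∑ x ∈ s, c x * (2 * (w x).re) ^ n : ℝ) : ℂ) = ∑ m ∈ Finset.range (n + 1),
      (n.choose m : ℂ) * ∑ x ∈ s, (c x : ℂ) * (w x ^ m * conj (w x) ^ (n - m)) := by
  simp only [Finset.mul_sum]
  rw [Finset.sum_comm]
  push_cast
  refine Finset.sum_congr rfl fun x _ => ?_
  rw [show (2 * ((w x).re : ℂ)) = w x + conj (w x) by
    rw [Complex.add_conj]; push_cast; ring, add_pow, Finset.mul_sum]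
  exact Finset.sum_congr rfl fun m _ => by ring

open ComplexConjugate in
lemma sum_mul_re_pow_two_mul {ι : Type*} (s : Finset ι) {k : ℕ} (c : ι → ℝ) (w : ι → ℂ)
    (h : ∀ i l, i + l ≤ k →
      ∑ x ∈ s, w x ^ i * conj (w x) ^ l * c x * conj (w x) ^ k = if i = k then 2 ^ k else 0) :
    ∑ x ∈ s, c x * (w x).re ^ (2 * k) = (2 * k).choose k / 2 ^ k := by
  have h1 : ∑ x ∈ s, c x * (2 * (w x).re) ^ (2 * k) = (2 * k).choose k * 2 ^ k := by
    apply Complex.ofReal_injective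
    rw [sum_mul_re_pow, Finset.sum_eq_single k]
    · rw [sum_mul_pow_mul_conj_pow_of_two_mul s c w h (by omega) (Or.inl le_rfl),
        if_pos (by omega)]
      push_cast; rfl
    · intro m hm hmk
      have := Finset.mem_range.1 hm
      rw [sum_mul_pow_mul_conj_pow_of_two_mul s c w h (by omega) (by omega), if_neg (by omega),
        mul_zero]
    · intro hk
      exact absurd (Finset.mem_range.2 (by omega)) hk
  simp only [mul_pow, mul_left_comm (c _), ← Finset.mul_sum] at h1
  have h2 : (2 : ℝ) ^ (2 * k) = 2 ^ k * 2 ^ k := by rw [two_mul, pow_add]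
  rw [h2] at h1
  have h3 : (2 : ℝ) ^ k ≠ 0 := by positivity
  rw [eq_div_iff h3]
  apply mul_left_cancel₀ h3
  linarith

open ComplexConjugate in
lemma sum_mul_re_pow_two_mul_sub_one {ι : Type*} (s : Finset ι) {k : ℕ} (hk : 1 ≤ k) (c : ι → ℝ)
    (w : ι → ℂ)
    (h : ∀ i l, i + l ≤ k →
      ∑ x ∈ s, w x ^ i * conj (w x) ^ l * c x * conj (w x) ^ k = if i = k then 2 ^ k else 0) :
    ∑ x ∈ s, c x * (w x).re ^ (2 * k - 1) = 0 := by
  have h1 : ∑ x ∈ s, c x * (2 * (w x).re) ^ (2 * k - 1) = 0 := by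
    apply Complex.ofReal_injective
    rw [sum_mul_re_pow, Finset.sum_eq_zero]
    · simp
    · intro m hm
      have := Finset.mem_range.1 hm
      rw [sum_mul_pow_mul_conj_pow_of_two_mul s c w h (by omega) (by omega), if_neg (by omega),
        mul_zero]
  simp only [mul_pow, mul_left_comm (c _), ← Finset.mul_sum] at h1
  exact (mul_eq_zero.1 h1).resolve_left (by positivity)

open Polynomial in
lemma sum_mul_inner_pow_mul_inner_sq {E : Type*} [NormedAddCommGroup E] [InnerProductSpace ℝ E]
    (s : Finset E) (c : E → ℝ) {n m : ℕ} {γ : ℝ}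
    (h : ∀ y, ∑ x ∈ s, c x * inner ℝ x y ^ (n + 2) = γ * (‖y‖ ^ 2) ^ (m + 1)) (y e : E) :
    (n + 2) * (n + 1) * ∑ x ∈ s, c x * (inner ℝ x y ^ n * inner ℝ x e ^ 2) =
      γ * (m + 1) * (4 * m * (‖y‖ ^ 2) ^ (m - 1) * inner ℝ y e ^ 2 +
        2 * (‖y‖ ^ 2) ^ m * ‖e‖ ^ 2) := by
  have hpoly : ∑ x ∈ s, C (c x) * (C (inner ℝ x y) + C (inner ℝ x e) * X) ^ (n + 2) =
      C γ * (C (‖y‖ ^ 2) + C (2 * inner ℝ y e) * X + C (‖e‖ ^ 2) * X ^ 2) ^ (m + 1) := by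
    apply Polynomial.funext
    intro t
    have ht := h (y + t • e)
    rw [norm_add_sq_real, norm_smul, mul_pow, Real.norm_eq_abs, sq_abs] at ht
    simp only [inner_add_right, inner_smul_right] at ht
    rw [eval_finsetSum]
    simp only [eval_mul, eval_C, eval_pow, eval_add, eval_X]
    convert ht using 2
    · ring
    · ring
  have hd := congrArg (fun p => eval 0 (derivative (derivative p))) hpoly
  simp only [derivative_pow, derivative_sum, derivative_mul, derivative_add, derivative_C,
    derivative_X, eval_finsetSum] at hd
  simp at hd
  rw [Finset.mul_sum]
  calc _ = _ := Finset.sum_congr rfl fun x _ => by ring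
    _ = _ := hd
    _ = _ := by ring

lemma sum_mul_inner_pow_of_add_two {E ι : Type*} [NormedAddCommGroup E] [InnerProductSpace ℝ E]
    [Fintype ι] (b : OrthonormalBasis ι ℝ E)
    (s : Finset E) (hs : ∀ x ∈ s, ‖x‖ = 1) (c : E → ℝ) {n m : ℕ} {γ : ℝ}
    (h : ∀ y, ∑ x ∈ s, c x * inner ℝ x y ^ (n + 2) = γ * (‖y‖ ^ 2) ^ (m + 1)) :
    ∃ γ', ∀ y, ∑ x ∈ s, c x * inner ℝ x y ^ n = γ' * (‖y‖ ^ 2) ^ m := by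
  refine ⟨γ * (m + 1) * (4 * m + 2 * Fintype.card ι) / ((n + 2) * (n + 1)), fun y => ?_⟩
  have hsum := Finset.sum_congr (rfl : (Finset.univ : Finset ι) = Finset.univ)
    fun i _ => sum_mul_inner_pow_mul_inner_sq s c h y (b i)
  have hl : ∑ i : ι, ∑ x ∈ s, c x * (inner ℝ x y ^ n * inner ℝ x (b i) ^ 2) =
      ∑ x ∈ s, c x * inner ℝ x y ^ n := by
    rw [Finset.sum_comm]
    refine Finset.sum_congr rfl fun x hx => ?_
    rw [← Finset.mul_sum, ← Finset.mul_sum, b.sum_sq_inner_left, hs x hx]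
    ring
  simp only [← Finset.mul_sum, Finset.sum_add_distrib, b.sum_sq_inner_left, b.norm_eq_one, hl]
    at hsum
  have hm : (m : ℝ) * (‖y‖ ^ 2) ^ (m - 1) * ‖y‖ ^ 2 = m * (‖y‖ ^ 2) ^ m := by
    cases m with
    | zero => simp
    | succ m => rw [Nat.add_sub_cancel, mul_assoc, ← pow_succ]
  have h0 : ((n : ℝ) + 2) * (n + 1) ≠ 0 := by positivity
  rw [div_mul_eq_mul_div, eq_div_iff h0, mul_comm, hsum]
  simp
  linear_combination (γ * (m + 1) * 4) * hm

lemma inner_eq_one_sub_dist_sq {E : Type*} [NormedAddCommGroup E] [InnerProductSpace ℝ E]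
    {x y : E} (hx : ‖x‖ = 1) (hy : ‖y‖ = 1) : inner ℝ x y = 1 - dist x y ^ 2 / 2 := by
  rw [dist_eq_norm, norm_sub_sq_real, hx, hy]
  ring

open Polynomial in
lemma exists_zonal_interpolant {d : ℕ} {X : Finset (EuclideanSpace ℝ (Fin d))}
    (hsph : ∀ x ∈ X, ‖x‖ = 1) {x : EuclideanSpace ℝ (Fin d)} (hx : x ∈ X) :
    ∃ f : ℝ[X], f.natDegree ≤ (distancesFrom X x).card ∧ f.eval 1 = 1 ∧
      ∀ y ∈ X, y ≠ x → f.eval (inner ℝ x y) = 0 := by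
  refine ⟨∏ r ∈ distancesFrom X x, (C (2 / r ^ 2) * (Polynomial.X - C (1 - r ^ 2 / 2))), ?_, ?_, ?_⟩
  · refine (natDegree_prod_le _ _).trans ?_
    rw [Finset.card_eq_sum_ones]
    exact Finset.sum_le_sum fun r _ => by compute_degree
  · rw [eval_prod]
    refine Finset.prod_eq_one fun r hr => ?_
    obtain ⟨y, hy, rfl⟩ := Finset.mem_image.1 hr
    have h0 : dist x y ≠ 0 := dist_ne_zero.2 (Finset.ne_of_mem_erase hy).symm
    simp only [eval_mul, eval_C, eval_sub, eval_X]
    field_simp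
    ring
  · intro y hy hyx
    rw [eval_prod]
    refine Finset.prod_eq_zero (i := dist x y)
      (Finset.mem_image.2 ⟨y, Finset.mem_erase.2 ⟨hyx, hy⟩, rfl⟩) ?_
    simp [inner_eq_one_sub_dist_sq (hsph x hx) (hsph y hy)]

open Polynomial in
lemma eq_sum_mul_zonal {d k : ℕ} {X : Finset (EuclideanSpace ℝ (Fin d))}
    (hsph : ∀ x ∈ X, ‖x‖ = 1) (hX : Module.finrank ℂ (spherePolys d k) ≤ X.card)
    {f : EuclideanSpace ℝ (Fin d) → ℝ[X]} (hdeg : ∀ x ∈ X, (f x).natDegree ≤ k)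
    (h1 : ∀ x ∈ X, (f x).eval 1 = 1)
    (h0 : ∀ x ∈ X, ∀ y ∈ X, y ≠ x → (f x).eval (inner ℝ x y) = 0)
    {p : EuclideanSpace ℝ (Fin d) → ℂ}
    (hp : (fun ξ : {ξ : EuclideanSpace ℝ (Fin d) // ‖ξ‖ = 1} => p ξ.1) ∈ spherePolys d k)
    {ξ : EuclideanSpace ℝ (Fin d)} (hξ : ‖ξ‖ = 1) :
    p ξ = ∑ x ∈ X, p x * (((f x).eval (inner ℝ x ξ) : ℝ) : ℂ) := by
  have : FiniteDimensional ℂ (spherePolys d k) := Module.Finite.iff_fg.2 (spherePolys_fg d k)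
  have h := eq_sum_eval_smul_of_finrank_le (ι := X) (spherePolys d k) (by simpa using hX)
    (fun x => ⟨x.1, hsph x.1 x.2⟩)
    (fun x ξ => (((f x.1).eval (inner ℝ x.1 ξ.1) : ℝ) : ℂ))
    (fun x => zonal_mem_spherePolys x.1 (hdeg x.1 x.2))
    (fun x y => by
      split_ifs with hxy
      · subst hxy
        simp [hsph x.1 x.2, h1 x.1 x.2]
      · simp [h0 x.1 x.2 y.1 y.2 fun h => hxy (Subtype.ext h.symm)]) _ hp
  have h2 := congrFun h ⟨ξ, hξ⟩
  simp only [Finset.sum_apply, Pi.smul_apply, smul_eq_mul] at h2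
  rw [h2]
  exact Finset.sum_coe_sort X fun x => p x * (((f x).eval (inner ℝ x ξ) : ℝ) : ℂ)

open Polynomial ComplexConjugate in
lemma sum_planar_pow_mul_coeff {d k : ℕ} {X : Finset (EuclideanSpace ℝ (Fin d))}
    (hsph : ∀ x ∈ X, ‖x‖ = 1) (hX : Module.finrank ℂ (spherePolys d k) ≤ X.card)
    {f : EuclideanSpace ℝ (Fin d) → ℝ[X]} (hdeg : ∀ x ∈ X, (f x).natDegree ≤ k)
    (h1 : ∀ x ∈ X, (f x).eval 1 = 1)
    (h0 : ∀ x ∈ X, ∀ y ∈ X, y ≠ x → (f x).eval (inner ℝ x y) = 0)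
    {u v : EuclideanSpace ℝ (Fin d)} (hu : ‖u‖ = 1) (hv : ‖v‖ = 1) (huv : inner ℝ u v = 0)
    {w : EuclideanSpace ℝ (Fin d) → ℂ} (hw : ∀ x, w x = ⟨inner ℝ u x, inner ℝ v x⟩)
    {i l : ℕ} (hil : i + l ≤ k) :
    ∑ x ∈ X, w x ^ i * conj (w x) ^ l * (f x).coeff k * conj (w x) ^ k =
      if i = k then 2 ^ k else 0 := by
  refine sum_mul_coeff_mul_conj_pow X f hdeg hil (fun x => w x ^ i * conj (w x) ^ l) w ?_
  intro ζ hζ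
  have hwmem : (fun ξ : {ξ : EuclideanSpace ℝ (Fin d) // ‖ξ‖ = 1} => w ξ.1) ∈
      sphereLinearForms d := by
    convert Submodule.add_mem _ (inner_mem_sphereLinearForms u)
      (Submodule.smul_mem _ Complex.I (inner_mem_sphereLinearForms v)) using 1
    funext ξ
    simp [hw, Complex.ext_iff]
  have hwmem' : (fun ξ : {ξ : EuclideanSpace ℝ (Fin d) // ‖ξ‖ = 1} => conj (w ξ.1)) ∈
      sphereLinearForms d := by
    convert Submodule.sub_mem _ (inner_mem_sphereLinearForms u)
      (Submodule.smul_mem _ Complex.I (inner_mem_sphereLinearForms v)) using 1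
    funext ξ
    simp [hw, Complex.ext_iff]
  have hmem : (fun ξ : {ξ : EuclideanSpace ℝ (Fin d) // ‖ξ‖ = 1} => w ξ.1 ^ i * conj (w ξ.1) ^ l) ∈
      spherePolys d k := by
    apply sphereLinearForms_pow_le_spherePolys d hil
    rw [pow_add]
    exact Submodule.mul_mem_mul (Submodule.pow_mem_pow _ hwmem i) (Submodule.pow_mem_pow _ hwmem' l)
  have hvu : inner ℝ v u = 0 := by rw [real_inner_comm, huv]
  have hζ2 : ζ.re ^ 2 + ζ.im ^ 2 = 1 := by
    have h := Complex.normSq_eq_norm_sq ζ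
    rw [Complex.normSq_apply, hζ] at h
    linarith
  have hξ : ‖ζ.re • u + ζ.im • v‖ = 1 := by
    have : ‖ζ.re • u + ζ.im • v‖ ^ 2 = 1 := by
      rw [norm_add_sq_real, norm_smul, norm_smul, inner_smul_left, inner_smul_right, huv, hu, hv]
      simpa using hζ2
    exact (pow_eq_one_iff_of_nonneg (norm_nonneg _) two_ne_zero).1 this
  have hwξ : w (ζ.re • u + ζ.im • v) = ζ := by
    rw [hw]
    simp [inner_add_right, inner_smul_right, huv, hvu, hu, hv]
  have h := eq_sum_mul_zonal hsph hX hdeg h1 h0 (p := fun ξ => w ξ ^ i * conj (w ξ) ^ l) hmem hξ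
  rw [hwξ] at h
  rw [h]
  refine Finset.sum_congr rfl fun x _ => ?_
  congr 4
  simp [hw, inner_add_right, inner_smul_right, real_inner_comm, mul_comm]

lemma exists_norm_eq_one_inner_eq_zero {d : ℕ} (hd : 2 ≤ d) (u : EuclideanSpace ℝ (Fin d)) :
    ∃ v : EuclideanSpace ℝ (Fin d), ‖v‖ = 1 ∧ inner ℝ u v = 0 := by
  have hne : (ℝ ∙ u)ᗮ ≠ ⊥ := by
    intro h
    rw [Submodule.orthogonal_eq_bot_iff] at h
    have h1 := (finrank_span_le_card (R := ℝ) ({u} : Set (EuclideanSpace ℝ (Fin d))))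
    rw [h, finrank_top, finrank_euclideanSpace_fin] at h1
    simp at h1
    omega
  obtain ⟨v, hv, hv0⟩ := Submodule.exists_mem_ne_zero_of_ne_bot hne
  refine ⟨‖v‖⁻¹ • v, norm_smul_inv_norm hv0, ?_⟩
  rw [inner_smul_right, Submodule.mem_orthogonal_singleton_iff_inner_right.1 hv, mul_zero]

lemma sum_mul_inner_pow_eq_of_unit {E : Type*} [NormedAddCommGroup E] [InnerProductSpace ℝ E]
    (s : Finset E) (c : E → ℝ) {n : ℕ} (hn : n ≠ 0) {γ : ℝ}
    (h : ∀ y, ‖y‖ = 1 → ∑ x ∈ s, c x * inner ℝ x y ^ n = γ) (y : E) :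
    ∑ x ∈ s, c x * inner ℝ x y ^ n = γ * ‖y‖ ^ n := by
  rcases eq_or_ne y 0 with rfl | hy
  · simp [hn]
  · rw [← h (‖y‖⁻¹ • y) (norm_smul_inv_norm hy), Finset.sum_mul]
    refine Finset.sum_congr rfl fun x _ => ?_
    have := norm_ne_zero_iff.2 hy
    rw [inner_smul_right, mul_assoc, ← mul_pow]
    congr 2
    field_simp

lemma exists_sum_mul_inner_pow_eq {d k : ℕ} (hk : 1 ≤ k) {γ : ℝ}
    {s : Finset (EuclideanSpace ℝ (Fin d))} (hs : ∀ x ∈ s, ‖x‖ = 1)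
    {c : EuclideanSpace ℝ (Fin d) → ℝ}
    (heven : ∀ y, ‖y‖ = 1 → ∑ x ∈ s, c x * inner ℝ x y ^ (2 * k) = γ)
    (hodd : ∀ y, ‖y‖ = 1 → ∑ x ∈ s, c x * inner ℝ x y ^ (2 * k - 1) = 0) {n : ℕ}
    (hn : n ≤ 2 * k) :
    ∃ γ' : ℝ, ∀ y, ‖y‖ = 1 → ∑ x ∈ s, c x * inner ℝ x y ^ n = γ' := by
  have key : ∀ j n, n + j = 2 * k → ∃ γ' : ℝ, ∀ y,
      ∑ x ∈ s, c x * inner ℝ x y ^ n = γ' * (‖y‖ ^ 2) ^ ((n + 1) / 2) := by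
    intro j
    induction j using Nat.twoStepInduction with
    | zero =>
      rintro n rfl
      refine ⟨γ, fun y => ?_⟩
      rw [sum_mul_inner_pow_eq_of_unit s c (by omega) heven, ← pow_mul]
      congr 2
      omega
    | one =>
      intro n hn
      obtain rfl : n = 2 * k - 1 := by omega
      refine ⟨0, fun y => ?_⟩
      rw [sum_mul_inner_pow_eq_of_unit s c (by omega) hodd, zero_mul, zero_mul]
    | more j ih _ =>
      intro n hn
      obtain ⟨γ', h⟩ := ih (n + 2) (by omega)
      rw [show (n + 2 + 1) / 2 = (n + 1) / 2 + 1 by omega] at h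
      exact sum_mul_inner_pow_of_add_two (EuclideanSpace.basisFun (Fin d) ℝ) s hs c h
  obtain ⟨γ', h⟩ := key (2 * k - n) n (by omega)
  exact ⟨γ', fun y hy => by simp [h y, hy]⟩

open Polynomial in
lemma sum_mul_eval_inner_eq {d N : ℕ} {s : Finset (EuclideanSpace ℝ (Fin d))}
    {c : EuclideanSpace ℝ (Fin d) → ℝ}
    (h : ∀ n ≤ N, ∃ γ : ℝ, ∀ y, ‖y‖ = 1 → ∑ x ∈ s, c x * inner ℝ x y ^ n = γ)
    {p : ℝ[X]} (hp : p.natDegree ≤ N) {y z : EuclideanSpace ℝ (Fin d)} (hy : ‖y‖ = 1)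
    (hz : ‖z‖ = 1) :
    ∑ x ∈ s, c x * p.eval (inner ℝ x y) = ∑ x ∈ s, c x * p.eval (inner ℝ x z) := by
  have hexp : ∀ y, ∑ x ∈ s, c x * p.eval (inner ℝ x y) =
      ∑ n ∈ Finset.range (N + 1), p.coeff n * ∑ x ∈ s, c x * inner ℝ x y ^ n := by
    intro y
    simp only [eval_eq_sum_range' (Nat.lt_succ_of_le hp), Finset.mul_sum]
    rw [Finset.sum_comm]
    exact Finset.sum_congr rfl fun _ _ => Finset.sum_congr rfl fun _ _ => by ring
  rw [hexp, hexp]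
  refine Finset.sum_congr rfl fun n hn => ?_
  obtain ⟨γ, hγ⟩ := h n (Finset.mem_range_succ_iff.1 hn)
  rw [hγ y hy, hγ z hz]

open Polynomial in
/-- If the leading coefficients of the zonal interpolants of `X` have rotation invariant moments
up to order `2k`, every interpolant vanishes at all inner products of distinct points of `X`. -/
lemma zonal_eval_inner_eq_zero {d k : ℕ} {X : Finset (EuclideanSpace ℝ (Fin d))}
    (hsph : ∀ x ∈ X, ‖x‖ = 1) {f : EuclideanSpace ℝ (Fin d) → ℝ[X]}
    {c : EuclideanSpace ℝ (Fin d) → ℝ}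
    (hdeg : ∀ x ∈ X, (f x).natDegree ≤ k)
    (h1 : ∀ x ∈ X, (f x).eval 1 = 1)
    (h0 : ∀ x ∈ X, ∀ y ∈ X, y ≠ x → (f x).eval (inner ℝ x y) = 0)
    (hmom : ∀ n ≤ 2 * k, ∃ γ : ℝ, ∀ y, ‖y‖ = 1 → ∑ x ∈ X, c x * inner ℝ x y ^ n = γ)
    {y₀ : EuclideanSpace ℝ (Fin d)} (hpos : 0 < ∑ x ∈ X, c x * inner ℝ x y₀ ^ (2 * k)) :
    (∀ x ∈ X, 0 < c x) ∧
      ∀ x ∈ X, ∀ y ∈ X, ∀ z ∈ X, z ≠ y → (f x).eval (inner ℝ z y) = 0 := by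
  have hself : ∀ x ∈ X, ∀ g : ℝ[X], ∑ z ∈ X, c z * (f x * g).eval (inner ℝ z x) = c x * g.eval 1 := by
    intro x hx g
    rw [Finset.sum_eq_single_of_mem x hx]
    · simp [hsph x hx, h1 x hx]
    · intro z hz hzx
      rw [eval_mul, real_inner_comm, h0 x hx z hz hzx, zero_mul, mul_zero]
  have hmul : ∀ x ∈ X, ∀ y ∈ X, (f x * f y).natDegree ≤ 2 * k := fun x hx y hy =>
    natDegree_mul_le.trans (by have := hdeg x hx; have := hdeg y hy; omega)
  have hc : ∀ x ∈ X, ∀ y ∈ X, c x = c y := by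
    intro x hx y hy
    have h := sum_mul_eval_inner_eq hmom (hmul x hx y hy) (hsph x hx) (hsph y hy)
    rw [hself x hx, mul_comm (f x), hself y hy, h1 x hx, h1 y hy] at h
    simpa using h
  have hcpos : ∀ x ∈ X, 0 < c x := by
    intro x hx
    rw [Finset.sum_congr rfl fun z hz => by rw [hc z hz x hx], ← Finset.mul_sum] at hpos
    exact pos_of_mul_pos_left hpos (Finset.sum_nonneg fun z _ => (even_two_mul k).pow_nonneg _)
  refine ⟨hcpos, fun x hx y hy z hz hzy => ?_⟩
  have h := sum_mul_eval_inner_eq hmom (hmul x hx x hx) (hsph x hx) (hsph y hy)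
  rw [hself x hx, h1 x hx, ← Finset.add_sum_erase X _ hy, real_inner_self_eq_norm_sq, hsph y hy,
    one_pow, eval_mul, h1 x hx, hc y hy x hx] at h
  have h2 : ∑ z ∈ X.erase y, c z * (f x * f x).eval (inner ℝ z y) = 0 := by linarith
  rw [Finset.sum_eq_zero_iff_of_nonneg] at h2
  · have h3 := h2 z (Finset.mem_erase.2 ⟨hzy, hz⟩)
    rw [eval_mul] at h3
    simpa [(hcpos z hz).ne'] using h3
  · intro z hz
    rw [eval_mul]
    exact mul_nonneg (hcpos z (Finset.mem_of_mem_erase hz)).le (mul_self_nonneg _)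

lemma distancesFrom_subset_distSet {d : ℕ} {X : Finset (EuclideanSpace ℝ (Fin d))}
    {x : EuclideanSpace ℝ (Fin d)} (hx : x ∈ X) : distancesFrom X x ⊆ distSet X := by
  intro r hr
  obtain ⟨y, hy, rfl⟩ := Finset.mem_image.1 hr
  obtain ⟨hyx, hy⟩ := Finset.mem_erase.1 hy
  exact Finset.mem_image.2 ⟨(x, y), Finset.mem_offDiag.2 ⟨hx, hy, hyx.symm⟩, rfl⟩

open Polynomial in
lemma card_distSet_le_natDegree {d : ℕ} {X : Finset (EuclideanSpace ℝ (Fin d))}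
    (hsph : ∀ x ∈ X, ‖x‖ = 1) {f : ℝ[X]} (hf : f ≠ 0)
    (h : ∀ y ∈ X, ∀ z ∈ X, z ≠ y → f.eval (inner ℝ z y) = 0) :
    (distSet X).card ≤ f.natDegree := by
  refine (Finset.card_le_card_of_injOn (fun r => 1 - r ^ 2 / 2) (t := f.roots.toFinset) ?_ ?_).trans
    ((Multiset.toFinset_card_le _).trans (card_roots' f))
  · intro r hr
    obtain ⟨⟨z, y⟩, hzy, rfl⟩ := Finset.mem_image.1 hr
    obtain ⟨hz, hy, hne⟩ := Finset.mem_offDiag.1 hzy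
    simp only [Finset.mem_coe, Multiset.mem_toFinset, mem_roots hf, IsRoot.def]
    rw [← inner_eq_one_sub_dist_sq (hsph z hz) (hsph y hy)]
    exact h y hy z hz hne
  · intro r hr t ht hrt
    obtain ⟨p, -, rfl⟩ := Finset.mem_image.1 hr
    obtain ⟨q, -, rfl⟩ := Finset.mem_image.1 ht
    have h2 : dist p.1 p.2 ^ 2 = dist q.1 q.2 ^ 2 := by
      simp only at hrt
      linarith
    exact (pow_left_inj₀ dist_nonneg dist_nonneg two_ne_zero).1 h2

/-- If `X` is a locally `k`-distance set on the unit sphere `S^{d-1}` attaining the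
Fisher-type bound `|X| = binom(d+k-1,k) + binom(d+k-2,k-1)`, then `X` is a `k`-distance
set. -/
theorem stmt18 (d k : ℕ) (hd : 2 ≤ d) (hk : 1 ≤ k)
    (X : Finset (EuclideanSpace ℝ (Fin d)))
    (hsph : ∀ x ∈ X, ‖x‖ = 1)
    (hloc : ∀ x ∈ X, (distancesFrom X x).card ≤ k)
    (hcard : X.card = (d + k - 1).choose k + (d + k - 2).choose (k - 1)) :
    (distSet X).card = k := by
  have hX : Module.finrank ℂ (spherePolys d k) ≤ X.card :=
    hcard ▸ finrank_spherePolys_le d hk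
  have hex : ∀ x, ∃ f : Polynomial ℝ, x ∈ X → f.natDegree ≤ (distancesFrom X x).card ∧
      f.eval 1 = 1 ∧ ∀ y ∈ X, y ≠ x → f.eval (inner ℝ x y) = 0 := fun x => by
    by_cases hx : x ∈ X
    · obtain ⟨f, hf⟩ := exists_zonal_interpolant hsph hx
      exact ⟨f, fun _ => hf⟩
    · exact ⟨0, fun h => absurd h hx⟩
  choose f hf using hex
  have hdeg : ∀ x ∈ X, (f x).natDegree ≤ k := fun x hx => (hf x hx).1.trans (hloc x hx)
  have h1 : ∀ x ∈ X, (f x).eval 1 = 1 := fun x hx => (hf x hx).2.1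
  have h0 : ∀ x ∈ X, ∀ y ∈ X, y ≠ x → (f x).eval (inner ℝ x y) = 0 := fun x hx => (hf x hx).2.2
  have hmoments : ∀ u, ‖u‖ = 1 →
      ∑ x ∈ X, (f x).coeff k * inner ℝ x u ^ (2 * k) = (2 * k).choose k / 2 ^ k ∧
      ∑ x ∈ X, (f x).coeff k * inner ℝ x u ^ (2 * k - 1) = 0 := by
    intro u hu
    obtain ⟨v, hv, huv⟩ := exists_norm_eq_one_inner_eq_zero hd u
    have h := fun i l (hil : i + l ≤ k) => sum_planar_pow_mul_coeff hsph hX hdeg h1 h0 hu hv huv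
      (w := fun x => ⟨inner ℝ u x, inner ℝ v x⟩) (fun _ => rfl) hil
    have h2 := sum_mul_re_pow_two_mul X (fun x => (f x).coeff k) _ h
    have h3 := sum_mul_re_pow_two_mul_sub_one X hk (fun x => (f x).coeff k) _ h
    simp only [real_inner_comm _ u] at h2 h3
    exact ⟨h2, h3⟩
  obtain ⟨x, hx⟩ : X.Nonempty := by
    rw [← Finset.card_pos, hcard]
    exact Nat.add_pos_left (Nat.choose_pos (by omega)) _
  obtain ⟨hpos, hzero⟩ := zonal_eval_inner_eq_zero hsph hdeg h1 h0
    (fun n hn => exists_sum_mul_inner_pow_eq hk hsph (fun u hu => (hmoments u hu).1)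
      (fun u hu => (hmoments u hu).2) hn)
    (y₀ := x) (by
      rw [(hmoments x (hsph x hx)).1]
      have := Nat.choose_pos (show k ≤ 2 * k by omega)
      positivity)
  have hfx : f x ≠ 0 := fun h => by simpa [h] using h1 x hx
  refine le_antisymm ((card_distSet_le_natDegree hsph hfx (hzero x hx)).trans (hdeg x hx)) ?_
  exact (Polynomial.le_natDegree_of_ne_zero (hpos x hx).ne').trans
    ((hf x hx).1.trans (Finset.card_le_card (distancesFrom_subset_distSet hx)))
end

section
/- If there exists a proper locally two-distance set X in ℝ^d (d ≥ 3) with |X| > d(d+1)/2, then there exists a two-distance set on the sphere S^{d-2} with N_{d-1}(2) = binom(d,2) + binom(d-1,1) = d(d+1)/2 - 1 points (i.e., a tight spherical four-design in S^{d-2}). -/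
open scoped Classical

section PolynomialMethod

variable {κ V : Type*} [NormedAddCommGroup V] [InnerProductSpace ℝ V]
  [FiniteDimensional ℝ V]

theorem card_le_of_linearIndependent_of_mem_span [Fintype κ] {ι M : Type*} [Fintype ι] [AddCommGroup M]
    [Module ℝ M] {v : κ → M} {g : ι → M} (hv : LinearIndependent ℝ v)
    (h : ∀ k, v k ∈ Submodule.span ℝ (Set.range g)) : Fintype.card κ ≤ Fintype.card ι := by
  have : Module.Finite ℝ (Submodule.span ℝ (Set.range g)) :=
    FiniteDimensional.span_of_finite ℝ (Set.finite_range g)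
  rw [← finrank_span_eq_card hv]
  exact (Submodule.finrank_mono (Submodule.span_le.2 (Set.range_subset_iff.2 h))).trans
    (finrank_range_le_card g)

theorem linearIndependent_of_diagonal [Fintype κ] {f : κ → κ → ℝ} (hd : ∀ k, f k k ≠ 0)
    (h : ∀ k l, k ≠ l → f k l = 0) : LinearIndependent ℝ f := by
  rw [Fintype.linearIndependent_iff]
  intro c hc k
  have hk := congrFun hc k
  simp only [Finset.sum_apply, Pi.smul_apply, smul_eq_mul, Pi.zero_apply] at hk
  rw [Finset.sum_eq_single k (fun l _ hl => by rw [h l k hl, mul_zero]) (by simp)] at hk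
  exact (mul_eq_zero.1 hk).resolve_right (hd k)

/-- The coordinate functions of a family of vectors, as functions of the index. -/
noncomputable def coordFun (v : κ → V) (i : Fin (Module.finrank ℝ V)) : κ → ℝ :=
  fun k => inner ℝ (stdOrthonormalBasis ℝ V i) (v k)

/-- The products of two coordinate functions of a family of vectors. -/
noncomputable def coordMulFun (v : κ → V) : Sym2 (Fin (Module.finrank ℝ V)) → κ → ℝ :=
  Sym2.lift ⟨fun i j => coordFun v i * coordFun v j, fun _ _ => mul_comm _ _⟩

theorem inner_eq_sum_coordFun (v : κ → V) (x : V) :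
    (fun l => inner ℝ x (v l)) =
      ∑ i, inner ℝ x (stdOrthonormalBasis ℝ V i) • coordFun v i := by
  ext l
  simp [coordFun, OrthonormalBasis.sum_inner_mul_inner]

theorem inner_mem_span (v : κ → V) (x : V) :
    (fun l => inner ℝ x (v l)) ∈ Submodule.span ℝ (Set.range (coordFun v)) := by
  rw [inner_eq_sum_coordFun]
  exact Submodule.sum_mem _ fun i _ =>
    Submodule.smul_mem _ _ (Submodule.subset_span ⟨i, rfl⟩)

theorem inner_sq_mem_span (v : κ → V) (x : V) :
    (fun l => inner ℝ x (v l) ^ 2) ∈ Submodule.span ℝ (Set.range (coordMulFun v)) := by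
  have : (fun l => inner ℝ x (v l) ^ 2) = (fun l => inner ℝ x (v l)) * fun l => inner ℝ x (v l) := by
    ext l
    simp [sq]
  rw [this, inner_eq_sum_coordFun, Finset.sum_mul_sum]
  refine Submodule.sum_mem _ fun i _ => Submodule.sum_mem _ fun j _ => ?_
  rw [smul_mul_smul_comm]
  exact Submodule.smul_mem _ _ (Submodule.subset_span ⟨s(i, j), rfl⟩)

theorem norm_sq_mem_span (v : κ → V) :
    (fun l => ‖v l‖ ^ 2) ∈ Submodule.span ℝ (Set.range (coordMulFun v)) := by
  have : (fun l => ‖v l‖ ^ 2) = ∑ i, coordFun v i * coordFun v i := by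
    ext l
    rw [← real_inner_self_eq_norm_sq, ← (stdOrthonormalBasis ℝ V).sum_inner_mul_inner]
    simp [coordFun, real_inner_comm]
  rw [this]
  exact Submodule.sum_mem _ fun i _ => Submodule.subset_span ⟨s(i, i), rfl⟩

theorem two_mul_card_sym2 (n : ℕ) : 2 * Fintype.card (Sym2 (Fin n)) = n * (n + 1) := by
  rw [Sym2.card, Fintype.card_fin, Nat.choose_two_right, Nat.add_sub_cancel,
    Nat.two_mul_div_two_of_even, mul_comm]
  rw [mul_comm]
  exact Nat.even_mul_succ_self n

/-- The Fisher type bound for spherical locally two-distance sets. -/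
theorem two_mul_card_le_of_locally_two_inner [Fintype κ] {v : κ → V} {r : ℝ} (hr : r ≠ 0)
    (hv : ∀ k, ‖v k‖ = r) (s t : κ → ℝ) (hs : ∀ k, s k ≠ r ^ 2) (ht : ∀ k, t k ≠ r ^ 2)
    (h : ∀ k l, k ≠ l → inner ℝ (v k) (v l) = s k ∨ inner ℝ (v k) (v l) = t k) :
    2 * Fintype.card κ ≤ Module.finrank ℝ V * (Module.finrank ℝ V + 3) := by
  have hli : LinearIndependent ℝ
      fun k l : κ => (inner ℝ (v k) (v l) - s k) * (inner ℝ (v k) (v l) - t k) := by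
    refine linearIndependent_of_diagonal (fun k => ?_) fun k l hkl => ?_
    · rw [real_inner_self_eq_norm_sq, hv]
      exact mul_ne_zero (sub_ne_zero.2 (hs k).symm) (sub_ne_zero.2 (ht k).symm)
    · rcases h k l hkl with h | h <;> simp [h]
  have key := card_le_of_linearIndependent_of_mem_span
    (g := Sum.elim (coordMulFun v) (coordFun v)) hli fun k => by
      have hexp : (fun l : κ => (inner ℝ (v k) (v l) - s k) * (inner ℝ (v k) (v l) - t k)) =
          (fun l => inner ℝ (v k) (v l) ^ 2) + (s k * t k / r ^ 2) • (fun l => ‖v l‖ ^ 2)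
            - (s k + t k) • (fun l => inner ℝ (v k) (v l)) := by
        ext l
        simp only [Pi.add_apply, Pi.sub_apply, Pi.smul_apply, smul_eq_mul, hv]
        field_simp
        ring
      rw [hexp, Set.Sum.elim_range, Submodule.span_union]
      exact Submodule.sub_mem _
        (Submodule.mem_sup_left (Submodule.add_mem _ (inner_sq_mem_span v _)
          (Submodule.smul_mem _ _ (norm_sq_mem_span v))))
        (Submodule.mem_sup_right (Submodule.smul_mem _ _ (inner_mem_span v _)))
  rw [Fintype.card_sum, Fintype.card_fin] at key
  linarith [two_mul_card_sym2 (Module.finrank ℝ V)]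

/-- The improved bound for spherical two-distance sets whose inner products have nonnegative sum. -/
theorem two_mul_card_le_of_two_inner_of_add_nonneg [Fintype κ] {v : κ → V} {r : ℝ} (hr : r ≠ 0)
    (hv : ∀ k, ‖v k‖ = r) {s t : ℝ} (hs : s < r ^ 2) (ht : t < r ^ 2) (hst : 0 ≤ s + t)
    (h : ∀ k l, k ≠ l → inner ℝ (v k) (v l) = s ∨ inner ℝ (v k) (v l) = t) :
    2 * Fintype.card κ ≤ Module.finrank ℝ V * (Module.finrank ℝ V + 1) := by
  have hli : LinearIndependent ℝ
      fun k l : κ => inner ℝ (v k) (v l) ^ 2 + s * t / r ^ 2 * ‖v l‖ ^ 2 := by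
    rw [Fintype.linearIndependent_iff]
    intro c hc
    set u := ∑ k, c k • v k with hu
    have hev : ∀ l, c l * ((r ^ 2 - s) * (r ^ 2 - t)) = -(s + t) * inner ℝ u (v l) := by
      intro l
      have hl := congrFun hc l
      simp only [Finset.sum_apply, Pi.smul_apply, smul_eq_mul, Pi.zero_apply] at hl
      have hsum : ∑ k, c k * ((inner ℝ (v k) (v l) - s) * (inner ℝ (v k) (v l) - t)) =
          -(s + t) * inner ℝ u (v l) := by
        rw [hu, sum_inner, Finset.mul_sum, ← sub_eq_zero, ← Finset.sum_sub_distrib, ← hl]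
        refine Finset.sum_congr rfl fun k _ => ?_
        rw [real_inner_smul_left, hv]
        field_simp
        ring
      rw [← hsum, Finset.sum_eq_single l, real_inner_self_eq_norm_sq, hv]
      · intro k _ hkl
        rcases h k l hkl with h | h <;> simp [h]
      · simp
    have hD : 0 < (r ^ 2 - s) * (r ^ 2 - t) := mul_pos (sub_pos.2 hs) (sub_pos.2 ht)
    have hle : ((r ^ 2 - s) * (r ^ 2 - t)) * ∑ l, c l ^ 2 ≤ 0 := by
      have : ((r ^ 2 - s) * (r ^ 2 - t)) * ∑ l, c l ^ 2 = -((s + t) * inner ℝ u u) := by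
        conv_rhs => rw [hu, inner_sum, ← hu, Finset.mul_sum, ← Finset.sum_neg_distrib]
        rw [Finset.mul_sum]
        refine Finset.sum_congr rfl fun l _ => ?_
        rw [real_inner_smul_right]
        linear_combination c l * hev l
      rw [this]
      exact neg_nonpos.2 (mul_nonneg hst real_inner_self_nonneg)
    have h0 : ∑ l, c l ^ 2 = 0 :=
      le_antisymm (nonpos_of_mul_nonpos_right hle hD) (Finset.sum_nonneg fun _ _ => sq_nonneg _)
    intro k
    exact pow_eq_zero_iff two_ne_zero |>.1
      ((Finset.sum_eq_zero_iff_of_nonneg fun _ _ => sq_nonneg _).1 h0 k (Finset.mem_univ k))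
  rw [← two_mul_card_sym2]
  refine Nat.mul_le_mul_left 2 (card_le_of_linearIndependent_of_mem_span
    (g := coordMulFun v) hli fun k => ?_)
  exact Submodule.add_mem _ (inner_sq_mem_span v _)
    (Submodule.smul_mem _ (s * t / r ^ 2) (norm_sq_mem_span v))

/-- The bound for spherical one-distance sets. -/
theorem card_le_finrank_add_one_of_inner_eq [Fintype κ] {v : κ → V} {s : ℝ} (hv : ∀ k, ‖v k‖ ^ 2 ≠ s)
    (h : ∀ k l, k ≠ l → inner ℝ (v k) (v l) = s) :
    Fintype.card κ ≤ Module.finrank ℝ V + 1 := by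
  have hli : LinearIndependent ℝ fun k l : κ => inner ℝ (v k) (v l) - s := by
    refine linearIndependent_of_diagonal (fun k => ?_) fun k l hkl => ?_
    · rw [real_inner_self_eq_norm_sq]
      exact sub_ne_zero.2 (hv k)
    · rw [h k l hkl, sub_self]
  have key := card_le_of_linearIndependent_of_mem_span
    (g := Sum.elim (coordFun v) fun _ : Unit => 1) hli fun k => by
      have hexp : (fun l : κ => inner ℝ (v k) (v l) - s) =
          (fun l => inner ℝ (v k) (v l)) - s • (1 : κ → ℝ) := by
        ext l
        simp
      rw [hexp, Set.Sum.elim_range, Submodule.span_union]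
      exact Submodule.sub_mem _ (Submodule.mem_sup_left (inner_mem_span v _))
        (Submodule.mem_sup_right (Submodule.smul_mem _ _ (Submodule.subset_span ⟨(), rfl⟩)))
  simpa using key

end PolynomialMethod

section Configurations

variable {E : Type*} [NormedAddCommGroup E]

/-- All distances between distinct points of `P` are `a` or `b`. -/
def DistancesIn (P : Finset E) (a b : ℝ) : Prop :=
  0 < a ∧ 0 < b ∧ ∀ x ∈ P, ∀ y ∈ P, x ≠ y → dist x y = a ∨ dist x y = b

/-- From each point of `P` at most two distances to other points of `P` occur. -/
def LocallyTwoDistance (P : Finset E) : Prop :=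
  ∀ x ∈ P, ∃ a b, 0 < a ∧ 0 < b ∧ ∀ y ∈ P, x ≠ y → dist x y = a ∨ dist x y = b

/-- All distances between a point of `P` and a point of `Q` equal `a`. -/
def CrossDistance (P Q : Finset E) (a : ℝ) : Prop :=
  ∀ p ∈ P, ∀ q ∈ Q, dist p q = a

theorem CrossDistance.symm {P Q : Finset E} {a : ℝ} (h : CrossDistance P Q a) :
    CrossDistance Q P a :=
  fun q hq p hp => (dist_comm q p).trans (h p hp q hq)

theorem DistancesIn.symm {P : Finset E} {a b : ℝ} (h : DistancesIn P a b) : DistancesIn P b a :=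
  ⟨h.2.1, h.1, fun x hx y hy hxy => (h.2.2 x hx y hy hxy).symm⟩

theorem DistancesIn.locallyTwoDistance {P : Finset E} {a b : ℝ} (h : DistancesIn P a b) :
    LocallyTwoDistance P :=
  fun x hx => ⟨a, b, h.1, h.2.1, h.2.2 x hx⟩

theorem LocallyTwoDistance.mono {P Q : Finset E} (h : LocallyTwoDistance Q) (hPQ : P ⊆ Q) :
    LocallyTwoDistance P := fun x hx => by
  obtain ⟨a, b, ha, hb, hab⟩ := h x (hPQ hx)
  exact ⟨a, b, ha, hb, fun y hy => hab y (hPQ hy)⟩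

variable [InnerProductSpace ℝ E]

/-- The dimension of the affine span of a finite set of points. -/
noncomputable def affineDim (P : Finset E) : ℕ :=
  Module.finrank ℝ (vectorSpan ℝ (P : Set E))

theorem inner_eq_of_norm_eq {x y : E} {r : ℝ} (hx : ‖x‖ = r) (hy : ‖y‖ = r) :
    inner ℝ x y = r ^ 2 - dist x y ^ 2 / 2 := by
  rw [dist_eq_norm, norm_sub_sq_real, hx, hy]
  ring

theorem sub_mem_vectorSpan {P : Finset E} {x y : E} (hx : x ∈ P) (hy : y ∈ P) :
    x - y ∈ vectorSpan ℝ (P : Set E) :=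
  vsub_mem_vectorSpan ℝ (Finset.mem_coe.2 hx) (Finset.mem_coe.2 hy)

theorem isOrtho_vectorSpan {P Z : Finset E} (h : ∀ z ∈ Z, ∃ ρ, ∀ p ∈ P, dist p z = ρ) :
    vectorSpan ℝ (P : Set E) ⟂ vectorSpan ℝ (Z : Set E) := by
  rw [vectorSpan, vectorSpan, Submodule.isOrtho_span]
  rintro _ ⟨p, hp, p', hp', rfl⟩ _ ⟨z, hz, z', hz', rfl⟩
  have key : ∀ z ∈ Z, ‖p‖ ^ 2 - 2 * inner ℝ p z = ‖p'‖ ^ 2 - 2 * inner ℝ p' z := by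
    intro z hz
    obtain ⟨ρ, hρ⟩ := h z hz
    have h1 := norm_sub_sq_real p z
    have h2 := norm_sub_sq_real p' z
    rw [← dist_eq_norm, hρ p hp] at h1
    rw [← dist_eq_norm, hρ p' hp'] at h2
    linarith
  have h1 := key z hz
  have h2 := key z' hz'
  simp only [vsub_eq_sub, inner_sub_left, inner_sub_right]
  linarith

theorem CrossDistance.isOrtho {P Q : Finset E} {a : ℝ} (h : CrossDistance P Q a) :
    vectorSpan ℝ (P : Set E) ⟂ vectorSpan ℝ (Q : Set E) :=
  isOrtho_vectorSpan fun q hq => ⟨a, fun p hp => h p hp q hq⟩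

theorem CrossDistance.isOrtho_union {P Q R : Finset E} {a b : ℝ} (hQ : CrossDistance P Q a)
    (hR : CrossDistance P R b) :
    vectorSpan ℝ (P : Set E) ⟂ vectorSpan ℝ ((Q ∪ R : Finset E) : Set E) :=
  isOrtho_vectorSpan fun q hq => (Finset.mem_union.1 hq).elim
    (fun h => ⟨a, fun p hp => hQ p hp q h⟩) fun h => ⟨b, fun p hp => hR p hp q h⟩

variable [FiniteDimensional ℝ E]

theorem affineDim_pos {P : Finset E} (hP : 2 ≤ P.card) : 0 < affineDim P := by
  obtain ⟨x, hx, y, hy, hxy⟩ := Finset.one_lt_card.1 hP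
  have : Nontrivial (vectorSpan ℝ (P : Set E)) :=
    ⟨⟨⟨x - y, sub_mem_vectorSpan hx hy⟩, 0, fun h => hxy (sub_eq_zero.1 (congrArg Subtype.val h))⟩⟩
  exact Module.finrank_pos

/-- A set of points at a common distance from `q` lies on a sphere in its affine span. -/
theorem exists_isometry_to_sphere {P : Finset E} (hP : 2 ≤ P.card) {q : E} {ρ : ℝ}
    (hq : ∀ p ∈ P, dist p q = ρ) :
    ∃ (v : E → vectorSpan ℝ (P : Set E)) (r : ℝ), 0 < r ∧ (∀ p ∈ P, ‖v p‖ = r) ∧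
      ∀ p ∈ P, ∀ p' ∈ P, dist (v p) (v p') = dist p p' := by
  obtain ⟨x, hx, y, hy, hxy⟩ := Finset.one_lt_card.1 hP
  set V := vectorSpan ℝ (P : Set E)
  have hsub : ∀ p (hp : p ∈ P) p' (hp' : p' ∈ P),
      V.orthogonalProjectionOnto (p - q) - V.orthogonalProjectionOnto (p' - q) =
        ⟨p - p', sub_mem_vectorSpan hp hp'⟩ := by
    intro p hp p' hp'
    rw [← map_sub, sub_sub_sub_cancel_right]
    exact Submodule.orthogonalProjectionOnto_mem_subspace_eq_self ⟨p - p', _⟩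
  have hperp : ∀ p ∈ P,
      Vᗮ.orthogonalProjectionOnto (p - q) = Vᗮ.orthogonalProjectionOnto (x - q) := by
    intro p hp
    rw [← sub_eq_zero, ← map_sub, sub_sub_sub_cancel_right]
    exact Submodule.orthogonalProjectionOnto_orthogonal_apply_eq_zero
      (sub_mem_vectorSpan hp hx)
  have hnorm : ∀ p ∈ P, ‖V.orthogonalProjectionOnto (p - q)‖ =
      ‖V.orthogonalProjectionOnto (x - q)‖ := by
    intro p hp
    have h1 := Submodule.norm_sq_eq_add_norm_sq_projection (p - q) V
    have h2 := Submodule.norm_sq_eq_add_norm_sq_projection (x - q) V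
    rw [← dist_eq_norm, hq p hp, hperp p hp] at h1
    rw [← dist_eq_norm, hq x hx] at h2
    exact (sq_eq_sq₀ (norm_nonneg _) (norm_nonneg _)).1 (by linarith)
  refine ⟨fun p => V.orthogonalProjectionOnto (p - q), _, ?_, hnorm, fun p hp p' hp' => ?_⟩
  · refine lt_of_le_of_ne (norm_nonneg _) fun h0 => hxy ?_
    have hy0 := (hnorm y hy).trans h0.symm
    have := hsub x hx y hy
    rw [norm_eq_zero.1 h0.symm, norm_eq_zero.1 hy0, sub_zero] at this
    exact sub_eq_zero.1 (congrArg Subtype.val this).symm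
  · rw [dist_eq_norm, hsub p hp p' hp', dist_eq_norm]
    rfl

theorem LocallyTwoDistance.two_mul_card_le {P : Finset E} (h : LocallyTwoDistance P)
    (hP : 2 ≤ P.card) {q : E} {ρ : ℝ} (hq : ∀ p ∈ P, dist p q = ρ) :
    2 * P.card ≤ affineDim P * (affineDim P + 3) := by
  obtain ⟨v, r, hr, hv, hd⟩ := exists_isometry_to_sphere hP hq
  choose! a b ha hb hab using h
  have := two_mul_card_le_of_locally_two_inner (κ := P) (v := fun p => v p) hr.ne'
    (fun p => hv p p.2) (fun p => r ^ 2 - a p ^ 2 / 2) (fun p => r ^ 2 - b p ^ 2 / 2)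
    (fun p => by have := ha p p.2; simp [this.ne']) (fun p => by have := hb p p.2; simp [this.ne'])
    fun p p' hp => by
      rw [inner_eq_of_norm_eq (hv p p.2) (hv p' p'.2), hd p p.2 p' p'.2]
      exact (hab p p.2 p' p'.2 fun h => hp (Subtype.ext h)).imp (fun h => by rw [h])
        fun h => by rw [h]
  rwa [Fintype.card_coe] at this

theorem card_le_of_dist_eq {X : Finset E} {a : ℝ}
    (h : ∀ x ∈ X, ∀ y ∈ X, x ≠ y → dist x y = a) : X.card ≤ Module.finrank ℝ E + 2 := by
  rcases X.eq_empty_or_nonempty with rfl | ⟨q, hq⟩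
  · simp
  have hne : ∀ p : X.erase q, ‖(p : E) - q‖ = a := fun p =>
    (dist_eq_norm _ _).symm.trans
      (h p (Finset.mem_of_mem_erase p.2) q hq (Finset.ne_of_mem_erase p.2))
  have := card_le_finrank_add_one_of_inner_eq (κ := X.erase q) (v := fun p => (p : E) - q)
    (s := a ^ 2 - a ^ 2 / 2)
    (fun p => by
      have h0 : 0 < a := hne p ▸ norm_pos_iff.2 (sub_ne_zero.2 (Finset.ne_of_mem_erase p.2))
      rw [hne]
      have := pow_pos h0 2
      linarith)
    fun p p' hp => by
      rw [inner_eq_of_norm_eq (hne p) (hne p'), dist_sub_right, h p (Finset.mem_of_mem_erase p.2) p'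
        (Finset.mem_of_mem_erase p'.2) fun h => hp (Subtype.ext h)]
  rw [Fintype.card_coe, Finset.card_erase_of_mem hq] at this
  omega

theorem affineDim_add_le {P Q : Finset E}
    (h : vectorSpan ℝ (P : Set E) ⟂ vectorSpan ℝ (Q : Set E)) :
    affineDim P + affineDim Q ≤ Module.finrank ℝ E :=
  Submodule.finrank_add_finrank_le_of_disjoint h.disjoint

theorem affineDim_add_add_le {P Q R : Finset E} {a b c : ℝ} (hPQ : CrossDistance P Q a)
    (hPR : CrossDistance P R b) (hQR : CrossDistance Q R c) :
    affineDim P + affineDim Q + affineDim R ≤ Module.finrank ℝ E := by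
  have h1 := affineDim_add_le (hPQ.isOrtho_union hPR)
  have h2 : affineDim Q + affineDim R ≤ affineDim (Q ∪ R) := by
    have h0 := Submodule.finrank_sup_add_finrank_inf_eq (vectorSpan ℝ (Q : Set E))
      (vectorSpan ℝ (R : Set E))
    rw [hQR.isOrtho.disjoint.eq_bot, finrank_bot, add_zero] at h0
    rw [affineDim, affineDim, ← h0]
    refine Submodule.finrank_mono (sup_le ?_ ?_) <;> apply vectorSpan_mono <;> simp
  omega

/-- Three mutually orthogonal pieces are too small. -/
theorem card_add_card_add_card_le {P Q R : Finset E} {a b c : ℝ} (hPQ : CrossDistance P Q a)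
    (hPR : CrossDistance P R b) (hQR : CrossDistance Q R c) (hP : LocallyTwoDistance P)
    (hQ : LocallyTwoDistance Q) (hR : LocallyTwoDistance R) (hP2 : 2 ≤ P.card) (hQ2 : 2 ≤ Q.card)
    (hR2 : 2 ≤ R.card) :
    2 * (P.card + Q.card + R.card) ≤ Module.finrank ℝ E * (Module.finrank ℝ E + 1) := by
  obtain ⟨p, hp⟩ := Finset.card_pos.1 (two_pos.trans_le hP2)
  obtain ⟨q, hq⟩ := Finset.card_pos.1 (two_pos.trans_le hQ2)
  have h1 := hP.two_mul_card_le hP2 fun x hx => hPQ x hx q hq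
  have h2 := hQ.two_mul_card_le hQ2 fun x hx => hPQ.symm x hx p hp
  have h3 := hR.two_mul_card_le hR2 fun x hx => hPR.symm x hx p hp
  have hs := affineDim_add_add_le hPQ hPR hQR
  have p1 := affineDim_pos hP2
  have p2 := affineDim_pos hQ2
  have p3 := affineDim_pos hR2
  generalize affineDim P = l at *
  generalize affineDim Q = m at *
  generalize affineDim R = n at *
  have hmono := Nat.mul_le_mul hs (Nat.add_le_add_right hs 1)
  nlinarith [Nat.mul_le_mul_left l p2, Nat.mul_le_mul_left m p3, Nat.mul_le_mul_left n p1]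

/-- There is a two-distance set on the unit sphere of `ℝⁿ` attaining the Fisher type bound. -/
def HasTightTwoDistanceSet (n : ℕ) : Prop :=
  ∃ Y : Finset (EuclideanSpace ℝ (Fin n)),
    (∀ y ∈ Y, ‖y‖ = 1) ∧ (distSet Y).card = 2 ∧ 2 * Y.card = n * (n + 3)

theorem hasTightTwoDistanceSet_of_card_le {n : ℕ} (hn : 2 ≤ n) {P : Finset E} {a b : ℝ}
    (hP : DistancesIn P a b) {q : E} {ρ : ℝ} (hq : ∀ p ∈ P, dist p q = ρ)
    (hdim : affineDim P ≤ n) (hcard : n * (n + 3) ≤ 2 * P.card) : HasTightTwoDistanceSet n := by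
  have hP2 : 2 ≤ P.card := by nlinarith
  have hle := hP.locallyTwoDistance.two_mul_card_le hP2 hq
  have hdim_eq : affineDim P = n := by nlinarith
  rw [hdim_eq] at hle
  obtain ⟨v, r, hr, hv, hd⟩ := exists_isometry_to_sphere hP2 hq
  let e := ((stdOrthonormalBasis ℝ (vectorSpan ℝ (P : Set E))).reindex (finCongr hdim_eq)).repr
  let f : E → EuclideanSpace ℝ (Fin n) := fun p => e (r⁻¹ • v p)
  have hf : ∀ p ∈ P, ∀ p' ∈ P, dist (f p) (f p') = r⁻¹ * dist p p' := by
    intro p hp p' hp'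
    rw [e.dist_map, dist_smul₀, hd p hp p' hp', Real.norm_of_nonneg (inv_nonneg.2 hr.le)]
  have hinj : Set.InjOn f P := by
    intro p hp p' hp' h
    have := hf p hp p' hp'
    rw [h, dist_self, eq_comm, mul_eq_zero] at this
    exact dist_eq_zero.1 (this.resolve_left (inv_ne_zero hr.ne'))
  have hc : (P.image f).card = P.card := Finset.card_image_of_injOn hinj
  have hsub : distSet (P.image f) ⊆ {r⁻¹ * a, r⁻¹ * b} := by
    intro t ht
    simp only [distSet, Finset.mem_image, Finset.mem_offDiag, Prod.exists] at ht
    obtain ⟨_, _, ⟨⟨p, hp, rfl⟩, ⟨p', hp', rfl⟩, hne⟩, rfl⟩ := ht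
    rw [hf p hp p' hp', Finset.mem_insert, Finset.mem_singleton]
    exact (hP.2.2 p hp p' hp' fun h => hne (congrArg f h)).imp (fun h => by rw [h])
      fun h => by rw [h]
  refine ⟨P.image f, ?_, le_antisymm ((Finset.card_le_card hsub).trans Finset.card_le_two) ?_,
    by omega⟩
  · intro y hy
    obtain ⟨p, hp, rfl⟩ := Finset.mem_image.1 hy
    rw [e.norm_map, norm_smul, hv p hp, norm_inv, Real.norm_of_nonneg hr.le,
      inv_mul_cancel₀ hr.ne']
  · by_contra! hlt
    have hone : ∀ x ∈ P, ∀ y ∈ P, x ≠ y → ∀ z ∈ P, ∀ w ∈ P, z ≠ w → dist x y = dist z w := by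
      intro x hx y hy hxy z hz w hw hzw
      have hmem : ∀ x ∈ P, ∀ y ∈ P, x ≠ y → dist (f x) (f y) ∈ distSet (P.image f) :=
        fun x hx y hy hxy => Finset.mem_image.2 ⟨(f x, f y), Finset.mem_offDiag.2
          ⟨Finset.mem_image_of_mem f hx, Finset.mem_image_of_mem f hy,
            fun h => hxy (hinj hx hy h)⟩, rfl⟩
      have := Finset.card_le_one.1 (Nat.le_of_lt_succ hlt) _ (hmem x hx y hy hxy) _
        (hmem z hz w hw hzw)
      rw [hf x hx y hy, hf z hz w hw] at this
      exact mul_left_cancel₀ (inv_ne_zero hr.ne') this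
    obtain ⟨x, hx, y, hy, hxy⟩ := Finset.one_lt_card.1 hP2
    have hbound := card_le_finrank_add_one_of_inner_eq (κ := P) (v := fun p => v p)
      (s := r ^ 2 - dist x y ^ 2 / 2)
      (fun p => by rw [hv p p.2]; have := pow_pos (dist_pos.2 hxy) 2; linarith)
      fun p p' hp => by
        rw [inner_eq_of_norm_eq (hv p p.2) (hv p' p'.2), hd p p.2 p' p'.2,
          hone p p.2 p' p'.2 (fun h => hp (Subtype.ext h)) x hx y hy hxy]
    rw [Fintype.card_coe] at hbound
    change P.card ≤ affineDim P + 1 at hbound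
    nlinarith

theorem hasTightTwoDistanceSet_of_crossDistance {n : ℕ} (hn : 2 ≤ n)
    (hE : Module.finrank ℝ E = n + 1) {P Z : Finset E} {a b c a' c' : ℝ}
    (hPZ : CrossDistance P Z a) (hP : DistancesIn P b c) (hZ : DistancesIn Z a' c')
    (hP2 : 2 ≤ P.card) (hZ2 : 2 ≤ Z.card)
    (hcard : (n + 1) * (n + 2) + 2 ≤ 2 * (P.card + Z.card)) : HasTightTwoDistanceSet n := by
  obtain ⟨p, hp⟩ := Finset.card_pos.1 (two_pos.trans_le hP2)
  obtain ⟨z, hz⟩ := Finset.card_pos.1 (two_pos.trans_le hZ2)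
  have h1 := hP.locallyTwoDistance.two_mul_card_le hP2 fun x hx => hPZ x hx z hz
  have h2 := hZ.locallyTwoDistance.two_mul_card_le hZ2 fun x hx => hPZ.symm x hx p hp
  have hs := affineDim_add_le hPZ.isOrtho
  have p1 := affineDim_pos hP2
  have p2 := affineDim_pos hZ2
  rw [hE] at hs
  rcases Nat.lt_or_ge (affineDim Z) 2 with hZ1 | hZ1
  · have hdim : affineDim Z = 1 := by omega
    rw [hdim] at h2
    exact hasTightTwoDistanceSet_of_card_le hn hP (fun x hx => hPZ x hx z hz) (by omega)
      (by nlinarith)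
  rcases Nat.lt_or_ge (affineDim P) 2 with hP1 | hP1
  · have hdim : affineDim P = 1 := by omega
    rw [hdim] at h1
    exact hasTightTwoDistanceSet_of_card_le hn hZ (fun x hx => hPZ.symm x hx p hp) (by omega)
      (by nlinarith)
  exfalso
  generalize affineDim P = k at *
  generalize affineDim Z = m at *
  obtain ⟨k, rfl⟩ := Nat.exists_eq_add_of_le hP1
  obtain ⟨m, rfl⟩ := Nat.exists_eq_add_of_le hZ1
  have hmono := Nat.mul_le_mul hs (Nat.add_le_add_right hs 1)
  nlinarith [Nat.zero_le (k * m)]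

/-- If `P` and `Q` span complementary orthogonal directions and both lie on spheres about `r`, the
piece on the larger sphere satisfies the improved bound. -/
theorem two_mul_card_le_of_complementary {P Q : Finset E} {r : E} {α β γ : ℝ}
    (hPQ : CrossDistance P Q α) (hPR : CrossDistance P {r} β) (hQR : CrossDistance Q {r} γ)
    (hP : DistancesIn P α β) (hγ : 0 ≤ γ) (hγβ : γ ≤ β) (hQ : Q.Nonempty)
    (hdim : affineDim P + affineDim Q = Module.finrank ℝ E) :
    2 * P.card ≤ affineDim P * (affineDim P + 1) := by
  rcases P.eq_empty_or_nonempty with rfl | ⟨p, hp⟩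
  · simp
  obtain ⟨q, hq⟩ := hQ
  have hβ : 0 < β := hP.2.1
  have hr : r ∈ ({r} : Finset E) := Finset.mem_singleton_self r
  have hV : vectorSpan ℝ (P : Set E) = (vectorSpan ℝ (Q : Set E))ᗮ := by
    refine Submodule.eq_of_le_of_finrank_le hPQ.isOrtho ?_
    have := Submodule.finrank_add_finrank_orthogonal (vectorSpan ℝ (Q : Set E))
    unfold affineDim at hdim
    omega
  have hmem : ∀ p ∈ P, p - r ∈ vectorSpan ℝ (P : Set E) := by
    intro p hp
    rw [hV]
    exact (hPQ.symm.isOrtho_union hQR).symm (sub_mem_vectorSpan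
      (Finset.mem_union_left _ hp) (Finset.mem_union_right _ hr))
  have hpyth : α ^ 2 = β ^ 2 + γ ^ 2 := by
    have h0 := (Submodule.isOrtho_iff_inner_eq.1 (hPQ.isOrtho_union hPR)) _ (hmem p hp) _
      (sub_mem_vectorSpan (Finset.mem_union_left _ hq) (Finset.mem_union_right _ hr))
    have h1 := norm_sub_sq_real (p - r) (q - r)
    rw [sub_sub_sub_cancel_right, h0, ← dist_eq_norm, ← dist_eq_norm, ← dist_eq_norm,
      hPQ p hp q hq, hPR p hp r hr, hQR q hq r hr] at h1
    linarith
  have hnorm : ∀ p : P, ‖(⟨p - r, hmem p p.2⟩ : vectorSpan ℝ (P : Set E))‖ = β := fun p =>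
    (dist_eq_norm (p : E) r).symm.trans (hPR p p.2 r hr)
  have hα : 0 < α := hP.1
  have := two_mul_card_le_of_two_inner_of_add_nonneg (κ := P)
    (v := fun p => (⟨p - r, hmem p p.2⟩ : vectorSpan ℝ (P : Set E))) hβ.ne' hnorm
    (s := β ^ 2 - α ^ 2 / 2) (t := β ^ 2 - β ^ 2 / 2) (by nlinarith) (by nlinarith)
    (by nlinarith) fun p p' hp => by
      rw [inner_eq_of_norm_eq (hnorm p) (hnorm p'), Subtype.dist_eq, dist_sub_right]
      exact (hP.2.2 p p.2 p' p'.2 fun h => hp (Subtype.ext h)).imp (fun h => by rw [h])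
        fun h => by rw [h]
  rwa [Fintype.card_coe] at this

theorem hasTightTwoDistanceSet_of_singleton {n : ℕ} (hn : 2 ≤ n)
    (hE : Module.finrank ℝ E = n + 1) {P : Finset E} {q r : E} {α β : ℝ} (hqr : q ≠ r)
    (hPq : CrossDistance P {q} α) (hPr : CrossDistance P {r} β) (hP : DistancesIn P α β)
    (hcard : n * (n + 3) ≤ 2 * P.card) : HasTightTwoDistanceSet n := by
  have hdim := affineDim_add_le (hPq.isOrtho_union hPr)
  have hpos : 0 < affineDim ({q} ∪ {r} : Finset E) := affineDim_pos <| Finset.one_lt_card.2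
    ⟨q, Finset.mem_union_left _ (Finset.mem_singleton_self q), r,
      Finset.mem_union_right _ (Finset.mem_singleton_self r), hqr⟩
  exact hasTightTwoDistanceSet_of_card_le hn hP
    (fun p hp => hPq p hp q (Finset.mem_singleton_self q)) (by omega) hcard

theorem hasTightTwoDistanceSet_of_triangle_of_card_eq_one {n : ℕ} (hn : 2 ≤ n)
    (hE : Module.finrank ℝ E = n + 1) {P Q R : Finset E} {α β γ : ℝ}
    (hPQ : CrossDistance P Q α) (hPR : CrossDistance P R β) (hQR : CrossDistance Q R γ)
    (hP : DistancesIn P α β) (hQ : DistancesIn Q α γ) (hP0 : P.Nonempty) (hQ0 : Q.Nonempty)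
    (hR : R.card = 1) (hcard : (n + 1) * (n + 2) + 2 ≤ 2 * (P.card + Q.card + R.card)) :
    HasTightTwoDistanceSet n := by
  rw [hR] at hcard
  obtain ⟨r, rfl⟩ := Finset.card_eq_one.1 hR
  have hr : r ∈ ({r} : Finset E) := Finset.mem_singleton_self r
  have hP1 := hP0.card_pos
  have hQ1 := hQ0.card_pos
  obtain hQ1 | hQ2 : Q.card = 1 ∨ 2 ≤ Q.card := by omega
  · rw [hQ1] at hcard
    obtain ⟨q, rfl⟩ := Finset.card_eq_one.1 hQ1
    refine hasTightTwoDistanceSet_of_singleton hn hE (fun h => hQ.2.1.ne ?_) hPQ hPR hP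
      (by nlinarith)
    rw [← hQR q (Finset.mem_singleton_self q) r hr, h, dist_self]
  obtain hP1 | hP2 : P.card = 1 ∨ 2 ≤ P.card := by omega
  · rw [hP1] at hcard
    obtain ⟨p, rfl⟩ := Finset.card_eq_one.1 hP1
    refine hasTightTwoDistanceSet_of_singleton hn hE (fun h => hP.2.1.ne ?_) hPQ.symm hQR hQ
      (by nlinarith)
    rw [← hPR p (Finset.mem_singleton_self p) r hr, h, dist_self]
  exfalso
  have h1 := hP.locallyTwoDistance.two_mul_card_le hP2 fun x hx => hPR x hx r hr
  have h2 := hQ.locallyTwoDistance.two_mul_card_le hQ2 fun x hx => hQR x hx r hr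
  have hs := affineDim_add_le hPQ.isOrtho
  have p1 := affineDim_pos hP2
  have p2 := affineDim_pos hQ2
  have himp : affineDim P + affineDim Q = Module.finrank ℝ E →
      2 * P.card ≤ affineDim P * (affineDim P + 1) ∨
        2 * Q.card ≤ affineDim Q * (affineDim Q + 1) := fun hdim =>
    (le_total γ β).imp
      (fun h => two_mul_card_le_of_complementary hPQ hPR hQR hP hQ.2.1.le h hQ0 hdim)
      fun h => two_mul_card_le_of_complementary hPQ.symm hQR hPR hQ hP.2.1.le h hP0
        ((add_comm _ _).trans hdim)
  rw [hE] at hs himp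
  generalize affineDim P = k at *
  generalize affineDim Q = m at *
  obtain ⟨k, rfl⟩ := Nat.exists_eq_add_of_le' p1
  obtain ⟨m, rfl⟩ := Nat.exists_eq_add_of_le' p2
  rcases hs.lt_or_eq with hlt | heq
  · have hle : k + m + 2 ≤ n := by omega
    have hmono := Nat.mul_le_mul hle (Nat.add_le_add_right hle 3)
    nlinarith [Nat.zero_le (k * m)]
  · obtain rfl : n = k + m + 1 := by omega
    rcases himp heq with h | h
    · obtain rfl : k = 0 := by
        by_contra hk
        nlinarith [Nat.mul_le_mul_right (m + 1) (Nat.one_le_iff_ne_zero.2 hk)]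
      omega
    · obtain rfl : m = 0 := by
        by_contra hm
        nlinarith [Nat.mul_le_mul_right (k + 1) (Nat.one_le_iff_ne_zero.2 hm)]
      omega

theorem hasTightTwoDistanceSet_of_triangle {n : ℕ} (hn : 2 ≤ n)
    (hE : Module.finrank ℝ E = n + 1) {P Q R : Finset E} {α β γ : ℝ}
    (hPQ : CrossDistance P Q α) (hPR : CrossDistance P R β) (hQR : CrossDistance Q R γ)
    (hP : DistancesIn P α β) (hQ : DistancesIn Q α γ) (hR : DistancesIn R β γ)
    (hP0 : P.Nonempty) (hQ0 : Q.Nonempty) (hR0 : R.Nonempty)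
    (hcard : (n + 1) * (n + 2) + 2 ≤ 2 * (P.card + Q.card + R.card)) :
    HasTightTwoDistanceSet n := by
  have hP1 := hP0.card_pos
  have hQ1 := hQ0.card_pos
  have hR1 := hR0.card_pos
  obtain hR1 | hR2 : R.card = 1 ∨ 2 ≤ R.card := by omega
  · exact hasTightTwoDistanceSet_of_triangle_of_card_eq_one hn hE hPQ hPR hQR hP hQ hP0 hQ0 hR1
      hcard
  obtain hQ1 | hQ2 : Q.card = 1 ∨ 2 ≤ Q.card := by omega
  · exact hasTightTwoDistanceSet_of_triangle_of_card_eq_one hn hE hPR hPQ hQR.symm hP.symm hR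
      hP0 hR0 hQ1 (by omega)
  obtain hP1 | hP2 : P.card = 1 ∨ 2 ≤ P.card := by omega
  · exact hasTightTwoDistanceSet_of_triangle_of_card_eq_one hn hE hQR hPQ.symm hPR.symm hQ.symm
      hR.symm hQ0 hR0 hP1 (by omega)
  have := card_add_card_add_card_le hPQ hPR hQR hP.locallyTwoDistance hQ.locallyTwoDistance
    hR.locallyTwoDistance hP2 hQ2 hR2
  rw [hE] at this
  linarith

end Configurations

section Colorings

theorem eq_pair_of_card_le_two {c : Type*} {S : Finset c} {a b : c} (hS : S.card ≤ 2)
    (hab : a ≠ b) (ha : a ∈ S) (hb : b ∈ S) : S = {a, b} :=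
  (Finset.eq_of_subset_of_card_le (Finset.insert_subset ha (Finset.singleton_subset_iff.2 hb))
    (by rwa [Finset.card_pair hab])).symm

/-- A pairwise intersecting family of sets with at most two elements is a star or a triangle. -/
theorem exists_common_or_triangle {ι c : Type*} {X : Finset ι} (hX : X.Nonempty)
    {A : ι → Finset c} (hA : ∀ x ∈ X, (A x).card ≤ 2)
    (h : ∀ x ∈ X, ∀ y ∈ X, ∃ a, a ∈ A x ∧ a ∈ A y) :
    (∃ a, ∀ x ∈ X, a ∈ A x) ∨ ∃ α β γ, α ≠ β ∧ α ≠ γ ∧ β ≠ γ ∧ (∃ x ∈ X, A x = {α, β}) ∧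
      (∃ x ∈ X, A x = {α, γ}) ∧ (∃ x ∈ X, A x = {β, γ}) ∧
      ∀ x ∈ X, A x = {α, β} ∨ A x = {α, γ} ∨ A x = {β, γ} := by
  by_cases hstar : ∃ a, ∀ x ∈ X, a ∈ A x
  · exact Or.inl hstar
  right
  push Not at hstar
  obtain ⟨x, hx⟩ := hX
  obtain ⟨α, hα, -⟩ := h x hx x hx
  obtain ⟨y, hy, hαy⟩ := hstar α
  obtain ⟨β, hβ, hβy⟩ := h x hx y hy
  have hαβ : α ≠ β := fun h => hαy (h ▸ hβy)
  have hAx := eq_pair_of_card_le_two (hA x hx) hαβ hα hβ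
  obtain ⟨z, hz, hβz⟩ := hstar β
  have hαz : α ∈ A z := by
    obtain ⟨t, htx, htz⟩ := h x hx z hz
    rw [hAx, Finset.mem_insert, Finset.mem_singleton] at htx
    rcases htx with rfl | rfl
    exacts [htz, absurd htz hβz]
  obtain ⟨γ, hγy, hγz⟩ := h y hy z hz
  have hαγ : α ≠ γ := fun h => hαy (h ▸ hγy)
  have hβγ : β ≠ γ := fun h => hβz (h ▸ hγz)
  have hAy := eq_pair_of_card_le_two (hA y hy) hβγ hβy hγy
  have hAz := eq_pair_of_card_le_two (hA z hz) hαγ hαz hγz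
  refine ⟨α, β, γ, hαβ, hαγ, hβγ, ⟨x, hx, hAx⟩, ⟨z, hz, hAz⟩, ⟨y, hy, hAy⟩, fun w hw => ?_⟩
  have hmeet : ∀ {u v : c}, (∃ t ∈ X, A t = {u, v}) → u ∈ A w ∨ v ∈ A w := by
    rintro u v ⟨t, ht, hAt⟩
    obtain ⟨s, hst, hsw⟩ := h t ht w hw
    rw [hAt, Finset.mem_insert, Finset.mem_singleton] at hst
    rcases hst with rfl | rfl
    exacts [Or.inl hsw, Or.inr hsw]
  have hpair : ∀ {u v : c}, u ≠ v → u ∈ A w → v ∈ A w → A w = {u, v} :=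
    eq_pair_of_card_le_two (hA w hw)
  have m1 := hmeet ⟨x, hx, hAx⟩
  have m2 := hmeet ⟨z, hz, hAz⟩
  have m3 := hmeet ⟨y, hy, hAy⟩
  by_cases hαw : α ∈ A w
  · exact m3.elim (fun hβw => Or.inl (hpair hαβ hαw hβw))
      fun hγw => Or.inr (Or.inl (hpair hαγ hαw hγw))
  · exact Or.inr (Or.inr (hpair hβγ (m1.resolve_left hαw) (m2.resolve_left hαw)))

end Colorings

section LocallyTwoDistance

variable {d n : ℕ} {X : Finset (EuclideanSpace ℝ (Fin d))}

theorem mem_distancesFrom {x : EuclideanSpace ℝ (Fin d)} {t : ℝ} :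
    t ∈ distancesFrom X x ↔ ∃ y ∈ X, y ≠ x ∧ dist x y = t := by
  simp [distancesFrom, and_assoc, and_left_comm]

theorem dist_mem_distancesFrom {x y : EuclideanSpace ℝ (Fin d)} (hy : y ∈ X) (hxy : x ≠ y) :
    dist x y ∈ distancesFrom X x :=
  mem_distancesFrom.2 ⟨y, hy, hxy.symm, rfl⟩

theorem dist_mem_distancesFrom' {x y : EuclideanSpace ℝ (Fin d)} (hx : x ∈ X) (hxy : x ≠ y) :
    dist x y ∈ distancesFrom X y :=
  dist_comm x y ▸ dist_mem_distancesFrom hx hxy.symm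

theorem pos_of_mem_distancesFrom {x : EuclideanSpace ℝ (Fin d)} {t : ℝ}
    (ht : t ∈ distancesFrom X x) : 0 < t := by
  obtain ⟨y, -, hyx, rfl⟩ := mem_distancesFrom.1 ht
  exact dist_pos.2 hyx.symm

theorem mem_distSet {t : ℝ} : t ∈ distSet X ↔ ∃ x ∈ X, ∃ y ∈ X, x ≠ y ∧ dist x y = t := by
  simp [distSet, and_assoc]

theorem locallyTwoDistance_of_card_le (hloc : ∀ x ∈ X, (distancesFrom X x).card ≤ 2) {a : ℝ}
    (ha : ∀ x ∈ X, a ∈ distancesFrom X x) : LocallyTwoDistance X := by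
  intro x hx
  by_cases hb : ∃ b ∈ distancesFrom X x, a ≠ b
  · obtain ⟨b, hb, hab⟩ := hb
    refine ⟨a, b, pos_of_mem_distancesFrom (ha x hx), pos_of_mem_distancesFrom hb,
      fun y hy hxy => ?_⟩
    have := dist_mem_distancesFrom hy hxy
    rwa [eq_pair_of_card_le_two (hloc x hx) hab (ha x hx) hb, Finset.mem_insert,
      Finset.mem_singleton] at this
  · push Not at hb
    exact ⟨a, a, pos_of_mem_distancesFrom (ha x hx), pos_of_mem_distancesFrom (ha x hx),
      fun y hy hxy => Or.inl (hb _ (dist_mem_distancesFrom hy hxy)).symm⟩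

theorem distancesIn_filter {a b : ℝ} (ha : 0 < a) (hb : 0 < b) :
    DistancesIn (X.filter fun x => distancesFrom X x = {a, b}) a b := by
  refine ⟨ha, hb, fun x hx y hy hxy => ?_⟩
  rw [Finset.mem_filter] at hx hy
  have := dist_mem_distancesFrom hy.1 hxy
  rwa [hx.2, Finset.mem_insert, Finset.mem_singleton] at this

theorem crossDistance_filter {a b c : ℝ} (hab : a ≠ b) (hbc : b ≠ c) :
    CrossDistance (X.filter fun x => distancesFrom X x = {a, b})
      (X.filter fun x => distancesFrom X x = {a, c}) a := by
  intro x hx y hy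
  rw [Finset.mem_filter] at hx hy
  have hxy : x ≠ y := by
    rintro rfl
    have : b ∈ ({a, c} : Finset ℝ) := hy.2 ▸ hx.2 ▸ by simp
    simp [hab.symm, hbc] at this
  have h1 := dist_mem_distancesFrom hy.1 hxy
  have h2 := dist_mem_distancesFrom' hx.1 hxy
  rw [hx.2, Finset.mem_insert, Finset.mem_singleton] at h1
  rw [hy.2, Finset.mem_insert, Finset.mem_singleton] at h2
  rcases h1 with h1 | h1
  · exact h1
  · exact h2.resolve_right fun h => hbc (h1.symm.trans h)

theorem hasTightTwoDistanceSet_of_common_distance (hn : 2 ≤ n) (hd : d = n + 1)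
    (hloc : ∀ x ∈ X, (distancesFrom X x).card ≤ 2) (hdist : 2 < (distSet X).card)
    (hcard : (n + 1) * (n + 2) + 2 ≤ 2 * X.card) {a : ℝ}
    (ha : ∀ x ∈ X, a ∈ distancesFrom X x) : HasTightTwoDistanceSet n := by
  have hE : Module.finrank ℝ (EuclideanSpace ℝ (Fin d)) = n + 1 := by simp [hd]
  obtain ⟨b, hb, c, hc, hbc⟩ : ∃ b ∈ (distSet X).erase a, ∃ c ∈ (distSet X).erase a, b ≠ c := by
    refine Finset.one_lt_card.1 ?_
    have := Finset.pred_card_le_card_erase (s := distSet X) (a := a)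
    omega
  rw [Finset.mem_erase, mem_distSet] at hb hc
  have hmem : ∀ {t : ℝ}, a ≠ t → ∀ x ∈ X, t ∈ distancesFrom X x →
      x ∈ X.filter fun x => distancesFrom X x = {a, t} := fun hat x hx ht =>
    Finset.mem_filter.2 ⟨hx, eq_pair_of_card_le_two (hloc x hx) hat (ha x hx) ht⟩
  have htwo : ∀ {t : ℝ}, a ≠ t → (∃ x ∈ X, ∃ y ∈ X, x ≠ y ∧ dist x y = t) →
      0 < a ∧ 0 < t ∧ 2 ≤ (X.filter fun x => distancesFrom X x = {a, t}).card := by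
    rintro t hat ⟨x, hx, y, hy, hxy, rfl⟩
    exact ⟨pos_of_mem_distancesFrom (ha x hx), dist_pos.2 hxy, Finset.one_lt_card.2
      ⟨x, hmem hat x hx (dist_mem_distancesFrom hy hxy),
        y, hmem hat y hy (dist_mem_distancesFrom' hx hxy), hxy⟩⟩
  obtain ⟨ha0, hb0, hP2⟩ := htwo hb.1.symm hb.2
  obtain ⟨-, hc0, hQ2⟩ := htwo hc.1.symm hc.2
  have hP := distancesIn_filter (X := X) ha0 hb0
  have hQ := distancesIn_filter (X := X) ha0 hc0
  have hPQ := crossDistance_filter (X := X) hb.1.symm hbc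
  set W := X.filter fun x => b ∉ distancesFrom X x ∧ c ∉ distancesFrom X x
  have hcross : ∀ {t : ℝ}, (∀ x ∈ W, t ∉ distancesFrom X x) →
      CrossDistance (X.filter fun x => distancesFrom X x = {a, t}) W a := by
    intro t ht x hx w hw
    rw [Finset.mem_filter] at hx
    have hxw : x ≠ w := by
      rintro rfl
      exact ht x hw (by simp [hx.2])
    have h1 := dist_mem_distancesFrom (Finset.mem_filter.1 hw).1 hxw
    rw [hx.2, Finset.mem_insert, Finset.mem_singleton] at h1
    exact h1.resolve_right fun h => ht w hw (h ▸ dist_mem_distancesFrom' hx.1 hxw)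
  have hPW := hcross (t := b) fun x hx => (Finset.mem_filter.1 hx).2.1
  have hQW := hcross (t := c) fun x hx => (Finset.mem_filter.1 hx).2.2
  have hcover : X ⊆ (X.filter fun x => distancesFrom X x = {a, b}) ∪
      ((X.filter fun x => distancesFrom X x = {a, c}) ∪ W) := by
    intro x hx
    by_cases hbx : b ∈ distancesFrom X x
    · exact Finset.mem_union_left _ (hmem hb.1.symm x hx hbx)
    by_cases hcx : c ∈ distancesFrom X x
    · exact Finset.mem_union_right _ (Finset.mem_union_left _ (hmem hc.1.symm x hx hcx))
    · exact Finset.mem_union_right _ (Finset.mem_union_right _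
        (Finset.mem_filter.2 ⟨hx, hbx, hcx⟩))
  have hsum := (Finset.card_le_card hcover).trans (Finset.card_union_le _ _)
  rcases Nat.lt_or_ge W.card 2 with hW1 | hW2
  · have hW1 := Finset.card_le_one.1 (Nat.le_of_lt_succ hW1)
    refine hasTightTwoDistanceSet_of_crossDistance hn hE
      (Z := (X.filter fun x => distancesFrom X x = {a, c}) ∪ W) (a := a) ?_ hP
      (a' := a) (c' := c) ⟨ha0, hc0, ?_⟩ hP2
      (hQ2.trans (Finset.card_le_card Finset.subset_union_left)) (by omega)
    · exact fun x hx z hz => (Finset.mem_union.1 hz).elim (hPQ x hx z) (hPW x hx z)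
    · intro x hx y hy hxy
      rcases Finset.mem_union.1 hx with hx | hx <;> rcases Finset.mem_union.1 hy with hy | hy
      · exact hQ.2.2 x hx y hy hxy
      · exact Or.inl (hQW x hx y hy)
      · exact Or.inl (hQW.symm x hx y hy)
      · exact absurd (hW1 x hx y hy) hxy
  · exfalso
    have hW0 := (locallyTwoDistance_of_card_le hloc ha).mono (Finset.filter_subset _ X : W ⊆ X)
    have h3 := card_add_card_add_card_le hPQ hPW hQW hP.locallyTwoDistance hQ.locallyTwoDistance
      hW0 hP2 hQ2 hW2
    have h4 := Finset.card_union_le (X.filter fun x => distancesFrom X x = {a, c}) W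
    rw [hE] at h3
    linarith

theorem hasTightTwoDistanceSet_of_proper (hn : 2 ≤ n) (hd : d = n + 1)
    (hloc : ∀ x ∈ X, (distancesFrom X x).card ≤ 2) (hproper : (distSet X).card ≠ 2)
    (hcard : (n + 1) * (n + 2) + 2 ≤ 2 * X.card) : HasTightTwoDistanceSet n := by
  have hE : Module.finrank ℝ (EuclideanSpace ℝ (Fin d)) = n + 1 := by simp [hd]
  have hX : 1 < X.card := by nlinarith
  have hdist : 2 < (distSet X).card := by
    by_contra! hle
    have hone := Finset.card_le_one.1 (Nat.le_of_lt_succ (hle.lt_of_ne hproper))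
    obtain ⟨x, hx, y, hy, hxy⟩ := Finset.one_lt_card.1 hX
    have := card_le_of_dist_eq (X := X) (a := dist x y) fun z hz w hw hzw =>
      hone _ (mem_distSet.2 ⟨z, hz, w, hw, hzw, rfl⟩) _ (mem_distSet.2 ⟨x, hx, y, hy, hxy, rfl⟩)
    rw [hE] at this
    nlinarith
  have hmeet : ∀ x ∈ X, ∀ y ∈ X, ∃ t, t ∈ distancesFrom X x ∧ t ∈ distancesFrom X y := by
    intro x hx y hy
    rcases eq_or_ne x y with rfl | hxy
    · obtain ⟨z, hz, hzx⟩ := Finset.exists_mem_ne hX x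
      exact ⟨_, dist_mem_distancesFrom hz hzx.symm, dist_mem_distancesFrom hz hzx.symm⟩
    · exact ⟨_, dist_mem_distancesFrom hy hxy, dist_mem_distancesFrom' hx hxy⟩
  rcases exists_common_or_triangle (Finset.card_pos.1 (one_pos.trans hX)) hloc hmeet with
    ⟨a, ha⟩ | ⟨α, β, γ, hαβ, hαγ, hβγ, ⟨p, hp, hAp⟩, ⟨q, hq, hAq⟩, ⟨r, hr, hAr⟩, hall⟩
  · exact hasTightTwoDistanceSet_of_common_distance hn hd hloc hdist hcard ha
  have hα : 0 < α := pos_of_mem_distancesFrom (X := X) (x := p) (by simp [hAp])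
  have hβ : 0 < β := pos_of_mem_distancesFrom (X := X) (x := p) (by simp [hAp])
  have hγ : 0 < γ := pos_of_mem_distancesFrom (X := X) (x := q) (by simp [hAq])
  have hPR := crossDistance_filter (X := X) hαβ.symm hαγ
  have hQR := crossDistance_filter (X := X) hαγ.symm hαβ
  rw [Finset.pair_comm β α] at hPR
  rw [Finset.pair_comm γ α, Finset.pair_comm γ β] at hQR
  refine hasTightTwoDistanceSet_of_triangle hn hE (crossDistance_filter (X := X) hαβ hβγ) hPR hQR
    (distancesIn_filter hα hβ) (distancesIn_filter hα hγ) (distancesIn_filter hβ hγ)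
    ⟨p, Finset.mem_filter.2 ⟨hp, hAp⟩⟩ ⟨q, Finset.mem_filter.2 ⟨hq, hAq⟩⟩
    ⟨r, Finset.mem_filter.2 ⟨hr, hAr⟩⟩ (hcard.trans (Nat.mul_le_mul_left 2 ?_))
  refine (Finset.card_le_card fun x hx => ?_).trans ((Finset.card_union_le _ _).trans
    (Nat.add_le_add_right (Finset.card_union_le _ _) _))
  simp only [Finset.mem_union, Finset.mem_filter, hx, true_and, or_assoc]
  exact hall x hx

end LocallyTwoDistance

/-- If there is a proper locally two-distance set `X ⊆ ℝ^d` (`d ≥ 3`) with more than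
`d(d+1)/2` points, then there is a two-distance set on the unit sphere `S^{d-2} ⊆ ℝ^{d-1}`
with `N_{d-1}(2) = binom(d,2) + binom(d-1,1)` points. -/
theorem stmt19 (d : ℕ) (hd : 3 ≤ d) (X : Finset (EuclideanSpace ℝ (Fin d)))
    (hloc : ∀ x ∈ X, (distancesFrom X x).card ≤ 2)
    (hproper : (distSet X).card ≠ 2)
    (hcard : d * (d + 1) / 2 < X.card) :
    ∃ Y : Finset (EuclideanSpace ℝ (Fin (d - 1))),
      (∀ y ∈ Y, ‖y‖ = 1) ∧ (distSet Y).card = 2 ∧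
      Y.card = d.choose 2 + (d - 1).choose 1 := by
  obtain ⟨n, rfl⟩ := Nat.exists_eq_add_of_le' (one_le_two.trans (Nat.le_of_succ_le hd))
  have heven := Nat.two_mul_div_two_of_even (Nat.even_mul_succ_self (n + 1))
  obtain ⟨Y, hY, hY2, hYcard⟩ := hasTightTwoDistanceSet_of_proper (n := n) (by omega) rfl hloc
    hproper (by rw [show n + 2 = n + 1 + 1 from rfl]; omega)
  refine ⟨Y, hY, hY2, ?_⟩
  have hchoose : 2 * (n + 1).choose 2 = (n + 1) * n := by
    rw [Nat.choose_two_right, Nat.add_sub_cancel, Nat.two_mul_div_two_of_even]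
    rw [mul_comm]
    exact Nat.even_mul_succ_self n
  rw [Nat.choose_one_right]
  change Y.card = (n + 1).choose 2 + n
  linarith
end
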